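/- arXiv:1409.4321 — 3 statements merged into one kernel-verified Lean document; each statement's English description precedes it below -/
import Mathlib

section
/- Let K ⊆ ℂ be a nonempty compact set such that ℂ \ K is connected and the interior of K is empty. Let G_0 : K → ℂ^{n×n} be a continuous map taking Hermitian values, let G_1, …, G_p : K → ℂ^{n×n} be continuous, and for x ∈ ℂ^p, δ ∈ K define the Hermitian matrix G(x, δ) = G_0(δ) + Σ_{i=1}^p (x_i G_i(δ) + conj(x_i) G_i(δ)*). If for every δ ∈ K there exists x(δ) ∈ ℂ^p such that G(x(δ), δ) is positive definite, then there exist one-variable polynomials q_1, …, q_p ∈ ℂ[z] such that, setting x^•(δ) = (q_1(δ), …, q_p(δ)), the matrix G(x^•(δ), δ) is positive definite for every δ ∈ K. -/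
open Matrix
open scoped ComplexOrder


open MeasureTheory Set Filter Topology in
lemma aux_approx_integral {E : Type*} [NormedAddCommGroup E] [NormedSpace ℝ E] [CompleteSpace E]
    (C K : Set ℂ) (hC : IsCompact C) (κ : ℂ → ℂ → E) (Er : ℂ → ℂ → ℝ)
    (S : Submodule ℝ (ℂ → E))
    (h : ∀ z0 ∈ C, ∃ U ∈ 𝓝 z0, ∃ p ∈ S, ∀ w ∈ K, ∀ᵐ z, z ∈ U → ‖p w - κ w z‖ ≤ Er w z)
    (hκ : ∀ w ∈ K, IntegrableOn (κ w) C) (hE : ∀ w ∈ K, IntegrableOn (Er w) C) :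
    ∃ P ∈ S, ∀ w ∈ K, ‖P w - ∫ z in C, κ w z‖ ≤ ∫ z in C, Er w z := by
  let Q : Set ℂ → Prop := fun T => ∃ T₁, T ⊆ T₁ ∧ MeasurableSet T₁ ∧
    ∀ T', T' ⊆ T₁ → T' ⊆ C → MeasurableSet T' →
      ∃ P ∈ S, ∀ w ∈ K, ‖P w - ∫ z in T', κ w z‖ ≤ ∫ z in T', Er w z
  have hQ : Q C := by
    refine hC.induction_on (p := Q) ?_ ?_ ?_ ?_
    · refine ⟨∅, subset_rfl, MeasurableSet.empty, fun T' h1 _ _ => ⟨0, S.zero_mem, ?_⟩⟩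
      intro w hw
      rw [subset_empty_iff.mp h1]
      simp
    · rintro s t hst ⟨T₁, h1, h2⟩
      exact ⟨T₁, hst.trans h1, h2⟩
    · rintro s t ⟨T₁, h1, h2, h3⟩ ⟨T₂, k1, k2, k3⟩
      refine ⟨T₁ ∪ T₂, union_subset_union h1 k1, h2.union k2, ?_⟩
      intro T' hT hTC hTm
      obtain ⟨P, hP, hPw⟩ := h3 (T' ∩ T₁) inter_subset_right (inter_subset_left.trans hTC)
        (hTm.inter h2)
      obtain ⟨P', hP', hPw'⟩ := k3 (T' \ T₁) (by
        intro x hx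
        rcases hT hx.1 with h | h
        · exact absurd h hx.2
        · exact h) (sdiff_subset.trans hTC) (hTm.diff h2)
      refine ⟨P + P', S.add_mem hP hP', fun w hw => ?_⟩
      have e1 := integral_inter_add_sdiff h2 ((hκ w hw).mono_set hTC)
      have e2 := integral_inter_add_sdiff h2 ((hE w hw).mono_set hTC)
      rw [← e1, ← e2]
      have : (P + P') w - ((∫ z in T' ∩ T₁, κ w z) + ∫ z in T' \ T₁, κ w z) =
        (P w - ∫ z in T' ∩ T₁, κ w z) + (P' w - ∫ z in T' \ T₁, κ w z) := by
        simp only [Pi.add_apply]; abel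
      rw [this]
      exact (norm_add_le _ _).trans (add_le_add (hPw w hw) (hPw' w hw))
    · intro z0 hz0
      obtain ⟨U, hU, p, hp, hpw⟩ := h z0 hz0
      obtain ⟨V, hVU, hVo, hV⟩ := mem_nhds_iff.mp hU
      refine ⟨V, mem_nhdsWithin_of_mem_nhds (hVo.mem_nhds hV), V, subset_rfl,
        hVo.measurableSet, ?_⟩
      intro T' hT hTC hTm
      have hfin : volume T' < ⊤ := lt_of_le_of_lt (measure_mono hTC) hC.measure_lt_top
      refine ⟨(volume.real T') • p, S.smul_mem _ hp, fun w hw => ?_⟩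
      have e1 : (volume.real T') • p w = ∫ z in T', p w := by
        rw [setIntegral_const]
      rw [Pi.smul_apply, e1, ← integral_sub]
      · refine norm_integral_le_of_norm_le ((hE w hw).mono_set hTC) ?_
        rw [ae_restrict_iff' hTm]
        filter_upwards [hpw w hw] with z hz hzT using hz (hVU (hT hzT))
      · exact integrableOn_const hfin.ne
      · exact (hκ w hw).mono_set hTC
  obtain ⟨T₁, h1, _, h3⟩ := hQ
  exact h3 C h1 subset_rfl hC.measurableSet

open MeasureTheory Set Filter Topology in
lemma aux_radial (φ : ℝ → ℝ) (hφ : ∀ t, 0 ≤ φ t) (R : ℝ) (hR : 0 < R)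
    (hi : IntegrableOn (fun t => t * φ t) (Ioo 0 (3 * R))) (w : ℂ) (hw : ‖w‖ ≤ R) :
    IntegrableOn (fun z => φ ‖w - z‖) (Metric.closedBall 0 R) ∧
    ∫ z in Metric.closedBall 0 R, φ ‖w - z‖ ≤ 2 * Real.pi * ∫ t in Ioo 0 (3 * R), t * φ t := by
  have hsub : Metric.closedBall (0:ℂ) R ⊆ Metric.ball w (3 * R) := by
    intro z hz
    simp only [mem_closedBall_zero_iff, Metric.mem_ball, dist_eq_norm] at *
    have := norm_sub_le z w
    linarith
  have h1 : IntegrableOn (fun z : ℂ => φ ‖z‖) (Metric.ball 0 (3 * R)) := by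
    rw [integrableOn_fun_norm_addHaar volume]
    simpa using hi
  have hmp : MeasurePreserving (fun z : ℂ => z - w) volume volume :=
    measurePreserving_sub_right volume w
  have hme : MeasurableEmbedding (fun z : ℂ => z - w) := (MeasurableEquiv.subRight w).measurableEmbedding
  have hpre : (fun z : ℂ => z - w) ⁻¹' (Metric.ball 0 (3 * R)) = Metric.ball w (3 * R) := by
    ext z; simp [dist_eq_norm]
  have h2 : IntegrableOn (fun z => φ ‖w - z‖) (Metric.ball w (3 * R)) := by
    have := (hmp.integrableOn_comp_preimage hme).2 h1
    rw [hpre] at this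
    refine this.congr (Eventually.of_forall fun z => ?_)
    simp [norm_sub_rev]
  refine ⟨h2.mono_set hsub, ?_⟩
  have h3 : ∫ z in Metric.ball w (3 * R), φ ‖w - z‖ = ∫ z in Metric.ball (0:ℂ) (3 * R), φ ‖z‖ := by
    have := hmp.setIntegral_preimage_emb hme (fun z => φ ‖z‖) (Metric.ball 0 (3 * R))
    rw [hpre] at this
    rw [← this]
    simp only [norm_sub_rev]
  have h4 : ∫ z in Metric.ball (0:ℂ) (3 * R), φ ‖z‖ = 2 * Real.pi * ∫ t in Ioo 0 (3 * R), t * φ t := by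
    have := integral_fun_norm_addHaar (volume : Measure ℂ) ((Iio (3*R)).indicator φ)
    rw [← integral_indicator Metric.isOpen_ball.measurableSet]
    have e : (Metric.ball (0:ℂ) (3 * R)).indicator (fun z => φ ‖z‖) =
        fun z : ℂ => (Iio (3*R)).indicator φ ‖z‖ := by
      ext z; simp [indicator]
    rw [e, this]
    simp only [Complex.finrank_real_complex, Nat.add_one_sub_one, pow_one, smul_eq_mul,
      nsmul_eq_mul, Measure.real, Complex.volume_ball]
    have e2 : ∀ y : ℝ, y * (Iio (3*R)).indicator φ y = (Iio (3*R)).indicator (fun t => t * φ t) y := by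
      intro y; simp [indicator]
    simp only [e2]
    rw [setIntegral_indicator measurableSet_Iio, Ioi_inter_Iio]
    simp [mul_assoc]
  rw [← h4, ← h3]
  exact setIntegral_mono_set h2 (Eventually.of_forall fun z => hφ _) hsub.eventuallyLE

open MeasureTheory Set Filter Topology in
/-- singular kernel bounds -/
lemma aux_radial_half (R : ℝ) (hR : 0 < R) : ∃ C : ℝ, ∀ r : ℝ, 0 ≤ r → r ≤ R →
    ∀ w : ℂ, ‖w‖ ≤ R →
    IntegrableOn (fun z => |‖w - z‖ - r| ^ (-(1/2) : ℝ)) (Metric.closedBall 0 R) ∧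
    ∫ z in Metric.closedBall 0 R, |‖w - z‖ - r| ^ (-(1/2) : ℝ) ≤ C := by
  have hb : ∀ L : ℝ, IntegrableOn (fun u : ℝ => |u| ^ (-(1/2) : ℝ)) (Metric.ball 0 L) := by
    intro L
    have := (integrableOn_fun_norm_addHaar (volume : Measure ℝ) (f := fun y => y ^ (-(1/2) : ℝ)) (r := L)).2 
    simp only [Module.finrank_self, tsub_self, pow_zero, one_smul, Real.norm_eq_abs] at this
    apply this
    rcases le_or_gt L 0 with hL | hL
    · rw [Ioo_eq_empty (by simpa using hL)]; simp
    · exact (intervalIntegral.integrableOn_Ioo_rpow_iff hL).2 (by norm_num)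
  have hshift : ∀ r : ℝ, 0 ≤ r → r ≤ R → IntegrableOn (fun t : ℝ => |t - r| ^ (-(1/2) : ℝ)) (Ioo 0 (3*R)) ∧
      ∫ t in Ioo 0 (3*R), |t - r| ^ (-(1/2) : ℝ) ≤ ∫ u in Metric.ball (0:ℝ) (3*R), |u| ^ (-(1/2) : ℝ) := by
    intro r h0 h1
    have hmp : MeasurePreserving (fun z : ℝ => z - r) volume volume :=
      measurePreserving_sub_right volume r
    have hme : MeasurableEmbedding (fun z : ℝ => z - r) := (MeasurableEquiv.subRight r).measurableEmbedding
    have hpre : Ioo 0 (3*R) ⊆ (fun z : ℝ => z - r) ⁻¹' (Metric.ball 0 (3 * R)) := by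
      intro z hz
      simp only [mem_preimage, mem_ball_zero_iff, Real.norm_eq_abs, abs_lt]
      constructor <;> linarith [hz.1, hz.2]
    have h2 := (hmp.integrableOn_comp_preimage hme).2 (hb (3*R))
    refine ⟨h2.mono_set hpre, ?_⟩
    rw [← hmp.setIntegral_preimage_emb hme (fun u => |u| ^ (-(1/2) : ℝ)) (Metric.ball 0 (3*R))]
    exact setIntegral_mono_set h2 (Eventually.of_forall fun z => Real.rpow_nonneg (abs_nonneg _) _) hpre.eventuallyLE
  refine ⟨2 * Real.pi * (3 * R * ∫ u in Metric.ball (0:ℝ) (3*R), |u| ^ (-(1/2) : ℝ)), ?_⟩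
  intro r h0 h1 w hw
  obtain ⟨s1, s2⟩ := hshift r h0 h1
  have hempty : IntegrableOn (fun t : ℝ => t * |t - r| ^ (-(1/2) : ℝ)) (Ioo 0 (3*R)) := by
    refine Integrable.bdd_mul s1 (c := 3 * R) (by fun_prop) ?_
    rw [ae_restrict_iff' measurableSet_Ioo]
    refine Eventually.of_forall fun t ht => ?_
    rw [Real.norm_eq_abs, abs_of_pos ht.1]; exact ht.2.le
  obtain ⟨a1, a2⟩ := aux_radial (fun t => |t - r| ^ (-(1/2) : ℝ)) (fun t => by positivity) R hR hempty w hw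
  refine ⟨a1, a2.trans ?_⟩
  have : ∫ t in Ioo 0 (3 * R), t * |t - r| ^ (-(1/2) : ℝ) ≤ ∫ t in Ioo 0 (3 * R), 3 * R * |t - r| ^ (-(1/2) : ℝ) := by
    refine setIntegral_mono_on hempty (s1.const_mul _) measurableSet_Ioo ?_
    intro t ht
    exact mul_le_mul_of_nonneg_right ht.2.le (by positivity)
  rw [integral_const_mul] at this
  have h3 := mul_le_mul_of_nonneg_left s2 (by positivity : 0 ≤ 3 * R)
  have := this.trans h3
  gcongr

open MeasureTheory Set Filter Topology in
lemma aux_radial_three_half (R : ℝ) (hR : 0 < R) : ∃ C : ℝ, 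
    ∀ w : ℂ, ‖w‖ ≤ R →
    IntegrableOn (fun z => ‖w - z‖ ^ (-(3/2) : ℝ)) (Metric.closedBall 0 R) ∧
    ∫ z in Metric.closedBall 0 R, ‖w - z‖ ^ (-(3/2) : ℝ) ≤ C := by
  refine ⟨2 * Real.pi * ∫ t in Ioo 0 (3 * R), t * |t| ^ (-(3/2) : ℝ), fun w hw => ?_⟩
  have := aux_radial (fun t => |t| ^ (-(3/2) : ℝ)) (fun t => by positivity) R hR ?_ w hw
  · simpa using this
  · have h : IntegrableOn (fun t : ℝ => t ^ (-(1/2) : ℝ)) (Ioo 0 (3*R)) :=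
      (intervalIntegral.integrableOn_Ioo_rpow_iff (by positivity)).2 (by norm_num)
    refine h.congr_fun (fun t ht => ?_) measurableSet_Ioo
    simp only
    have ht0 : 0 < t := ht.1
    rw [abs_of_pos ht0]
    nth_rewrite 2 [← Real.rpow_one t]
    rw [← Real.rpow_add ht0]; norm_num

open MeasureTheory Set Filter Topology Real in
lemma aux_polar_integrable {E : Type*} [NormedAddCommGroup E] [NormedSpace ℝ E]
    (f : ℂ → E) (hf : Integrable f) :
    IntegrableOn (fun p : ℝ × ℝ => p.1 • f (Complex.polarCoord.symm p)) polarCoord.target := by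
  have h1 : Integrable (fun p : ℝ × ℝ => f (Complex.measurableEquivRealProd.symm p)) :=
    (Complex.volume_preserving_equiv_real_prod.symm.integrable_comp_emb
      Complex.measurableEquivRealProd.symm.measurableEmbedding).2 hf
  have h2 := (integrableOn_image_iff_integrableOn_abs_det_fderiv_smul volume
    polarCoord.open_target.measurableSet
    (fun p _ => (hasFDerivAt_polarCoord_symm p).hasFDerivWithinAt)
    polarCoord.symm.injOn (fun p : ℝ × ℝ => f (Complex.measurableEquivRealProd.symm p))).1
    h1.integrableOn
  refine h2.congr_fun (fun p hp => ?_) polarCoord.open_target.measurableSet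
  simp only [det_fderivPolarCoordSymm]
  rw [abs_of_pos hp.1, Complex.measurableEquivRealProd_symm_polarCoord_symm_apply]

open MeasureTheory Set Filter Topology Real in
lemma aux_polar_ball {E : Type*} [NormedAddCommGroup E] [NormedSpace ℝ E] [CompleteSpace E]
    (f : ℂ → E) (R : ℝ) (hR : 0 < R) (hf : IntegrableOn f (Metric.closedBall 0 R)) :
    ∫ z in Metric.closedBall 0 R, f z = ∫ t in (0:ℝ)..R, (2 * π * t) • circleAverage f 0 t := by
  have hm : MeasurableSet (Metric.closedBall (0:ℂ) R) := Metric.isClosed_closedBall.measurableSet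
  have h1 := aux_polar_integrable _ ((integrable_indicator_iff hm).2 hf)
  rw [← integral_indicator hm, ← Complex.integral_comp_polarCoord_symm]
  rw [polarCoord_target, Measure.volume_eq_prod] at *
  rw [setIntegral_prod _ h1, intervalIntegral.integral_of_le hR.le]
  have key : ∀ t ∈ Ioi (0:ℝ), ∫ θ in Ioo (-π) π, t • (Metric.closedBall (0:ℂ) R).indicator f
      (Complex.polarCoord.symm (t, θ)) =
      (Iic R).indicator (fun t => (2 * π * t) • circleAverage f 0 t) t := by
    intro t ht
    have ht : 0 < t := ht
    by_cases htR : t ≤ R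
    · rw [indicator_of_mem (show t ∈ Iic R from htR), circleAverage_eq_integral_add (-π),
        intervalIntegral.integral_comp_add_right (fun θ => f (circleMap 0 t θ)), smul_smul,
        ← integral_Ioc_eq_integral_Ioo, intervalIntegral.integral_of_le (by linarith [pi_pos]),
        integral_smul]
      have : 2 * π * t * (2 * π)⁻¹ = t := by field_simp
      rw [this]
      congr 1
      have e : (0 + -π) = -π := by ring
      have e' : (2 * π + -π) = π := by ring
      rw [e, e']
      congr 1
      ext θ
      rw [indicator_of_mem]
      · congr 1
        simp [circleMap, Complex.exp_mul_I]
      · simp [abs_of_pos ht, htR]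
    · rw [indicator_of_notMem (show t ∉ Iic R from htR)]
      refine integral_eq_zero_of_ae (Eventually.of_forall fun θ => ?_)
      simp only [Pi.zero_apply]
      rw [indicator_of_notMem, smul_zero]
      simp [abs_of_pos ht, lt_of_not_ge htR]
  rw [setIntegral_congr_fun measurableSet_Ioi key, setIntegral_indicator measurableSet_Iic,
    Ioi_inter_Iic]

open MeasureTheory Set Filter Topology Real in
lemma aux_log_potential (w : ℂ) (R : ℝ) (hR : 0 < R) (hw : ‖w‖ ≤ R)
    (hf : IntegrableOn (fun z => log ‖w - z‖) (Metric.closedBall 0 R)) :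
    ∫ z in Metric.closedBall 0 R, log ‖w - z‖ =
      π / 2 * ‖w‖ ^ 2 + (π * R ^ 2 * log R - π / 2 * R ^ 2) := by
  rw [aux_polar_ball _ R hR hf]
  set ρ := ‖w‖ with hρ
  have hρ0 : 0 ≤ ρ := norm_nonneg w
  have hca : ∀ t : ℝ, 0 < t → circleAverage (fun z => log ‖w - z‖) 0 t = log (max t ρ) := by
    intro t ht
    have e : (fun z => log ‖w - z‖) = fun z => log ‖z - w‖ := by
      ext z; rw [norm_sub_rev]
    rw [e, circleAverage_log_norm_sub_const_eq_log_radius_add_posLog ht.ne', zero_sub, norm_neg, ← hρ]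
    rcases le_or_gt ρ t with h | h
    · rw [max_eq_left h, (posLog_eq_zero_iff _).2, add_zero]
      rw [abs_of_nonneg (by positivity)]
      rw [inv_mul_le_iff₀ ht]; linarith
    · have hρp : 0 < ρ := ht.trans h
      rw [max_eq_right h.le, posLog_eq_log, log_mul (by positivity) hρp.ne', log_inv]
      · ring
      · rw [abs_of_nonneg (by positivity), le_inv_mul_iff₀ ht]; linarith
  have hcont : ∀ a b : ℝ, 0 ≤ a → a ≤ b → ∫ t in a..b, (2 * π * t) * log t =
      (π * b ^ 2 * log b - π / 2 * b ^ 2) - (π * a ^ 2 * log a - π / 2 * a ^ 2) := by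
    intro a b ha hab
    have hc : Continuous (fun t : ℝ => t * log t) := continuous_mul_log
    have hc1 : Continuous (fun t : ℝ => π * t ^ 2 * log t - π / 2 * t ^ 2) := by
      have : (fun t : ℝ => π * t ^ 2 * log t - π / 2 * t ^ 2) =
        fun t : ℝ => π * t * (t * log t) - π / 2 * t ^ 2 := by ext t; ring
      rw [this]; fun_prop
    have hc2 : Continuous (fun t : ℝ => 2 * π * t * log t) := by
      have : (fun t : ℝ => 2 * π * t * log t) =
        fun t : ℝ => 2 * π * (t * log t) := by ext t; ring
      rw [this]; fun_prop
    refine intervalIntegral.integral_eq_sub_of_hasDerivAt_of_le hab hc1.continuousOn ?_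
      (hc2.intervalIntegrable _ _)
    intro t ht
    have ht0 : t ≠ 0 := (ha.trans_lt ht.1).ne'
    have := (((hasDerivAt_pow 2 t).const_mul π).mul (hasDerivAt_log ht0)).sub
      ((hasDerivAt_pow 2 t).const_mul (π / 2))
    refine this.congr_deriv ?_
    field_simp
    simp
    ring
  have hI1 : ∫ t in (0:ℝ)..ρ, (2 * π * t) • circleAverage (fun z => log ‖w - z‖) 0 t =
      π * ρ ^ 2 * log ρ := by
    have : ∫ t in (0:ℝ)..ρ, (2 * π * t) • circleAverage (fun z => log ‖w - z‖) 0 t =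
      ∫ t in (0:ℝ)..ρ, t * (2 * π * log ρ) := by
      refine intervalIntegral.integral_congr_ae (Eventually.of_forall fun t ht => ?_)
      rw [uIoc_of_le hρ0] at ht
      rw [hca t ht.1, max_eq_right ht.2, smul_eq_mul]; ring
    rw [this, intervalIntegral.integral_mul_const, integral_id]; ring
  have hI2 : ∫ t in ρ..R, (2 * π * t) • circleAverage (fun z => log ‖w - z‖) 0 t =
      (π * R ^ 2 * log R - π / 2 * R ^ 2) - (π * ρ ^ 2 * log ρ - π / 2 * ρ ^ 2) := by
    rw [← hcont ρ R hρ0 hw]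
    refine intervalIntegral.integral_congr_ae (Eventually.of_forall fun t ht => ?_)
    rw [uIoc_of_le hw] at ht
    rw [hca t (hρ0.trans_lt ht.1), max_eq_left ht.1.le, smul_eq_mul]
  have hcts : Continuous (fun t : ℝ => 2 * π * t * log t) := by
    have : (fun t : ℝ => 2 * π * t * log t) =
        fun t : ℝ => 2 * π * (t * log t) := by ext t; ring
    rw [this]
    have hc : Continuous (fun t : ℝ => t * log t) := continuous_mul_log
    fun_prop
  rw [← intervalIntegral.integral_add_adjacent_intervals (b := ρ), hI1, hI2]
  · ring
  · refine IntervalIntegrable.congr_ae ((by fun_prop : Continuous fun t : ℝ => t * (2 * π * log ρ)).intervalIntegrable 0 ρ) ?_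
    rw [EventuallyEq, ae_restrict_iff' measurableSet_uIoc]
    refine Eventually.of_forall fun t ht => ?_
    rw [uIoc_of_le hρ0] at ht
    rw [hca t ht.1, max_eq_right ht.2, smul_eq_mul]; ring
  · refine IntervalIntegrable.congr_ae (hcts.intervalIntegrable ρ R) ?_
    rw [EventuallyEq, ae_restrict_iff' measurableSet_uIoc]
    refine Eventually.of_forall fun t ht => ?_
    rw [uIoc_of_le hw] at ht
    rw [hca t (hρ0.trans_lt ht.1), max_eq_left ht.1.le, smul_eq_mul]

open MeasureTheory Set Filter Topology Real in
lemma aux_cauchy_potential (w : ℂ) (R : ℝ) (hR : 0 < R) (hw : ‖w‖ ≤ R)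
    (hf : IntegrableOn (fun z => (w - z)⁻¹) (Metric.closedBall 0 R)) :
    ∫ z in Metric.closedBall 0 R, (w - z)⁻¹ = π * (starRingEnd ℂ) w := by
  rw [aux_polar_ball _ R hR hf]
  set ρ := ‖w‖ with hρ
  have hρ0 : 0 ≤ ρ := norm_nonneg w
  have hI : (2 * π * Complex.I : ℂ) ≠ 0 := by simp [pi_ne_zero]
  have hca1 : ∀ t : ℝ, 0 < t → t < ρ → circleAverage (fun z => (w - z)⁻¹) 0 t = w⁻¹ := by
    intro t ht htρ
    have hd : DifferentiableOn ℂ (fun z => (w - z)⁻¹) (Metric.closedBall 0 t) := by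
      intro z hz
      have : w - z ≠ 0 := by
        intro h
        rw [sub_eq_zero] at h
        rw [mem_closedBall_zero_iff, ← h] at hz
        linarith
      fun_prop (disch := assumption)
    rw [circleAverage_eq_circleIntegral ht.ne']
    have := hd.circleIntegral_sub_inv_smul (Metric.mem_ball_self ht)
    rw [this]
    rw [smul_smul, inv_mul_cancel₀ hI]; simp
  have hca2 : ∀ t : ℝ, ρ < t → circleAverage (fun z => (w - z)⁻¹) 0 t = 0 := by
    intro t ht
    have ht0 : 0 < t := hρ0.trans_lt ht
    rw [circleAverage_eq_circleIntegral ht0.ne']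
    by_cases hw0 : w = 0
    · have : ∮ z in C(0, t), (z - 0)⁻¹ • (w - z)⁻¹ = ∮ z in C(0, t), (-1:ℂ) * (z - 0) ^ (-2 : ℤ) := by
        congr 1
        ext z
        rw [hw0, _root_.zpow_neg]
        rcases eq_or_ne z 0 with h | h
        · simp [h]
        · simp; field_simp
      rw [this, circleIntegral.integral_const_mul, circleIntegral.integral_sub_zpow_of_ne (by norm_num)]
      simp
    · have : ∮ z in C(0, t), (z - 0)⁻¹ • (w - z)⁻¹ = ∮ z in C(0, t), w⁻¹ * ((z - 0)⁻¹ - (z - w)⁻¹) := by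
        refine circleIntegral.integral_congr ht0.le fun z hz => ?_
        have hz0 : z ≠ 0 := by
          rintro rfl; simp at hz; linarith
        have hzw : z - w ≠ 0 := by
          intro h; rw [sub_eq_zero] at h; rw [h] at hz; simp at hz; linarith
        have hzw' : w - z ≠ 0 := by
          intro h; apply hzw; rw [← neg_sub, h, neg_zero]
        simp only [smul_eq_mul, sub_zero]
        field_simp
        ring
      rw [this, circleIntegral.integral_const_mul, circleIntegral.integral_sub,
        circleIntegral.integral_sub_inv_of_mem_ball (Metric.mem_ball_self ht0),
        circleIntegral.integral_sub_inv_of_mem_ball (by simpa using ht)]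
      · simp
      · rw [circleIntegrable_sub_inv_iff]
        right; rw [abs_of_pos ht0]; simp [ht0.ne]
      · rw [circleIntegrable_sub_inv_iff]
        right; rw [abs_of_pos ht0]; simp only [mem_sphere_iff_norm, sub_zero]; exact ht.ne
  have ae1 : ∀ᵐ t : ℝ, t ∈ uIoc (0:ℝ) ρ → (2 * π * t) • circleAverage (fun z => (w - z)⁻¹) 0 t =
      ((t:ℝ):ℂ) * (2 * π * w⁻¹) := by
    have : ∀ᵐ t : ℝ, t ≠ ρ := by simp [ae_iff]
    filter_upwards [this] with t h1 ht
    rw [uIoc_of_le hρ0] at ht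
    rw [hca1 t ht.1 (lt_of_le_of_ne ht.2 h1)]
    simp only [Complex.real_smul]; push_cast; ring
  have ae2 : ∀ᵐ t : ℝ, t ∈ uIoc ρ R → (2 * π * t) • circleAverage (fun z => (w - z)⁻¹) 0 t = 0 := by
    refine Eventually.of_forall fun t ht => ?_
    rw [uIoc_of_le hw] at ht
    rw [hca2 t ht.1, smul_zero]
  rw [← intervalIntegral.integral_add_adjacent_intervals (b := ρ),
    intervalIntegral.integral_congr_ae ae1, intervalIntegral.integral_congr_ae ae2]
  · rw [intervalIntegral.integral_mul_const, intervalIntegral.integral_zero, add_zero,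
      intervalIntegral.integral_ofReal, integral_id]
    by_cases hw0 : w = 0
    · simp [hw0]
    · push_cast
      have : ((ρ:ℝ):ℂ) ^ 2 = w * (starRingEnd ℂ) w := by
        rw [Complex.mul_conj, Complex.normSq_eq_norm_sq, hρ]; push_cast; rfl
      rw [this]
      field_simp
      ring
  · refine IntervalIntegrable.congr_ae ((by fun_prop : Continuous fun t : ℝ => ((t:ℝ):ℂ) * (2 * π * w⁻¹)).intervalIntegrable 0 ρ) ?_
    rw [EventuallyEq, ae_restrict_iff' measurableSet_uIoc]
    filter_upwards [ae1] with t ht h using (ht h).symm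
  · refine IntervalIntegrable.congr_ae ((by fun_prop : Continuous fun t : ℝ => (0:ℂ)).intervalIntegrable ρ R) ?_
    rw [EventuallyEq, ae_restrict_iff' measurableSet_uIoc]
    filter_upwards [ae2] with t ht h using (ht h).symm

/-- real functions approximable by real parts of polynomials -/
def AuxPR (K : Set ℂ) (f : ℂ → ℝ) : Prop :=
  ∀ ε > 0, ∃ p : Polynomial ℂ, ∀ w ∈ K, |f w - (p.eval w).re| ≤ ε

/-- uniform closure of the polynomials -/
noncomputable def AuxA (K : Set ℂ) [CompactSpace K] : Subalgebra ℂ C(K, ℂ) :=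
  (polynomialFunctions K).topologicalClosure

lemma aux_mem_A (K : Set ℂ) [CompactSpace K] (f : C(K, ℂ)) : f ∈ AuxA K ↔
    ∀ ε > 0, ∃ p : Polynomial ℂ, ∀ w : K, ‖f w - p.eval (w : ℂ)‖ ≤ ε := by
  change f ∈ closure ((polynomialFunctions K : Subalgebra ℂ C(K, ℂ)) : Set C(K, ℂ)) ↔ _
  rw [Metric.mem_closure_iff]
  constructor
  · intro h ε hε
    obtain ⟨b, hb, hd⟩ := h ε hε
    rw [polynomialFunctions_coe] at hb
    obtain ⟨p, rfl⟩ := hb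
    refine ⟨p, fun w => ?_⟩
    have := ContinuousMap.dist_apply_le_dist (f := f) (g := Polynomial.toContinuousMapOnAlgHom K p) w
    rw [dist_eq_norm] at this
    exact this.trans hd.le
  · intro h ε hε
    obtain ⟨p, hp⟩ := h (ε / 2) (by positivity)
    refine ⟨Polynomial.toContinuousMapOnAlgHom K p, ?_, ?_⟩
    · rw [polynomialFunctions_coe]; exact ⟨p, rfl⟩
    · have h2 : dist f (Polynomial.toContinuousMapOnAlgHom K p) ≤ ε / 2 := by
        refine (ContinuousMap.dist_le (by positivity)).2 fun w => ?_
        rw [dist_eq_norm]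
        exact hp w
      exact lt_of_le_of_lt h2 (by linarith)

lemma aux_A_closed (K : Set ℂ) [CompactSpace K] : IsClosed (AuxA K : Set C(K, ℂ)) :=
  Subalgebra.isClosed_topologicalClosure _

/-- The identity. -/
def auxId (K : Set ℂ) : C(K, ℂ) := ⟨fun w => (w : ℂ), continuous_subtype_val⟩

lemma aux_id_mem (K : Set ℂ) [CompactSpace K] : auxId K ∈ AuxA K := by
  rw [aux_mem_A]
  intro ε hε
  exact ⟨Polynomial.X, fun w => by simp [auxId, hε.le]⟩

lemma aux_inv_mem (K : Set ℂ) [CompactSpace K] (hconn : IsConnected Kᶜ) (c : ℂ) (hc : c ∉ K) :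
    ∃ g ∈ AuxA K, ∀ w : K, g w = ((w : ℂ) - c)⁻¹ := by
  have hcl : IsClosed (AuxA K : Set C(K, ℂ)) := aux_A_closed K
  have hsp : spectrum ℂ (auxId K) = K := by
    rw [ContinuousMap.spectrum_eq_range]
    ext z; simp [auxId]
  have := Subalgebra.spectrum_eq_of_isPreconnected_compl (𝕜 := ℂ) (AuxA K)
    (⟨auxId K, aux_id_mem K⟩ : AuxA K) (by
      change IsPreconnected (spectrum ℂ (auxId K))ᶜ
      rw [hsp]; exact hconn.isPreconnected)
  change _ = spectrum ℂ (auxId K) at this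
  rw [hsp] at this
  rw [← this, spectrum.notMem_iff] at hc
  obtain ⟨u, hu⟩ := hc
  refine ⟨-((u⁻¹ : (AuxA K)ˣ) : AuxA K), (AuxA K).neg_mem (Subtype.property _), fun w => ?_⟩
  have h1 : ((u : AuxA K) : C(K, ℂ)) * ((u⁻¹ : (AuxA K)ˣ) : AuxA K) = 1 := by
    have := u.mul_inv
    exact congrArg Subtype.val this
  have h2 := congrArg (fun f : C(K, ℂ) => f w) h1
  rw [hu] at h2
  have h3 : (c - (w:ℂ)) * (((u⁻¹ : (AuxA K)ˣ) : AuxA K) : C(K, ℂ)) w = 1 := h2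
  rw [ContinuousMap.neg_apply, ← neg_sub c (w:ℂ), ← neg_inv, eq_inv_of_mul_eq_one_right h3]

lemma aux_log_A (K : Set ℂ) [CompactSpace K] (g : C(K, ℂ)) (hg : g ∈ AuxA K)
    (hb : ∀ w, ‖g w‖ ≤ 1 / 2) (ε : ℝ) (hε : 0 < ε) :
    ∃ p : Polynomial ℂ, ∀ w : K, |Real.log ‖1 + g w‖ - (p.eval (w : ℂ)).re| ≤ ε := by
  obtain ⟨n, hn⟩ := exists_pow_lt_of_lt_one (show 0 < ε / 4 by positivity)
    (show (1 / 2 : ℝ) < 1 by norm_num)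
  have hmem : (∑ j ∈ Finset.range (n + 1), ((-1 : ℂ) ^ (j + 1) / j) • g ^ j) ∈ AuxA K :=
    (AuxA K).sum_mem fun j _ => (AuxA K).smul_mem ((AuxA K).pow_mem hg j) _
  obtain ⟨p, hp⟩ := (aux_mem_A K _).1 hmem (ε / 2) (by positivity)
  refine ⟨p, fun w => ?_⟩
  have h1 := Complex.norm_log_sub_logTaylor_le n (z := g w) ((hb w).trans_lt (by norm_num))
  have h2 := hp w
  have h3 : (∑ j ∈ Finset.range (n + 1), ((-1 : ℂ) ^ (j + 1) / j) • g ^ j) w =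
      Complex.logTaylor (n + 1) (g w) := by
    rw [ContinuousMap.sum_apply]
    simp only [Complex.logTaylor]
    refine Finset.sum_congr rfl fun j _ => ?_
    simp only [ContinuousMap.smul_apply, ContinuousMap.pow_apply, smul_eq_mul]
    ring
  rw [h3] at h2
  have h4 : ‖g w‖ ^ (n + 1) * (1 - ‖g w‖)⁻¹ / (n + 1) ≤ ε / 2 := by
    have a1 : ‖g w‖ ^ (n + 1) ≤ (1 / 2) ^ (n + 1) := pow_le_pow_left₀ (norm_nonneg _) (hb w) _
    have a2 : (1 - ‖g w‖)⁻¹ ≤ 2 := by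
      rw [inv_le_comm₀ (by linarith [hb w]) (by norm_num)]
      linarith [hb w]
    have a3 : (1 / 2 : ℝ) ^ (n + 1) ≤ ε / 4 := by
      rw [pow_succ]
      have : (0:ℝ) < (1/2)^n := by positivity
      linarith
    have a4 : ‖g w‖ ^ (n + 1) * (1 - ‖g w‖)⁻¹ ≤ ε / 4 * 2 :=
      mul_le_mul (a1.trans a3) a2 (inv_nonneg.2 (by linarith [hb w])) (by positivity)
    have a5 : ‖g w‖ ^ (n + 1) * (1 - ‖g w‖)⁻¹ / (n + 1) ≤ ‖g w‖ ^ (n + 1) * (1 - ‖g w‖)⁻¹ := by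
      apply div_le_self
      · exact mul_nonneg (by positivity) (inv_nonneg.2 (by linarith [hb w]))
      · linarith [(Nat.cast_nonneg n : (0:ℝ) ≤ n)]
    linarith
  rw [← Complex.log_re, ← Complex.sub_re]
  refine (Complex.abs_re_le_norm _).trans ?_
  calc _ = ‖(Complex.log (1 + g w) - Complex.logTaylor (n + 1) (g w)) +
        (Complex.logTaylor (n + 1) (g w) - p.eval (w : ℂ))‖ := by congr 1; ring
    _ ≤ _ := norm_add_le _ _
    _ ≤ ε := by linarith

lemma aux_PR_add {K : Set ℂ} {f g : ℂ → ℝ} (hf : AuxPR K f) (hg : AuxPR K g) :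
    AuxPR K (fun w => f w + g w) := by
  intro ε hε
  obtain ⟨p, hp⟩ := hf (ε / 2) (by positivity)
  obtain ⟨q, hq⟩ := hg (ε / 2) (by positivity)
  refine ⟨p + q, fun w hw => ?_⟩
  have h1 := hp w hw
  have h2 := hq w hw
  rw [Polynomial.eval_add, Complex.add_re]
  rw [abs_le] at *
  constructor <;> linarith [h1.1, h1.2, h2.1, h2.2]

lemma aux_PR_neg {K : Set ℂ} {f : ℂ → ℝ} (hf : AuxPR K f) : AuxPR K (fun w => - f w) := by
  intro ε hε
  obtain ⟨p, hp⟩ := hf ε hε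
  refine ⟨-p, fun w hw => ?_⟩
  have h1 := hp w hw
  rw [Polynomial.eval_neg, Complex.neg_re]
  rw [abs_le] at *
  constructor <;> linarith [h1.1, h1.2]

lemma aux_PR_const {K : Set ℂ} (c : ℝ) : AuxPR K (fun _ => c) := by
  intro ε hε
  exact ⟨Polynomial.C (c : ℂ), fun w _ => by simp [hε.le]⟩

lemma aux_PR_congr {K : Set ℂ} {f g : ℂ → ℝ} (hf : AuxPR K f) (h : ∀ w ∈ K, f w = g w) :
    AuxPR K g := by
  intro ε hε
  obtain ⟨p, hp⟩ := hf ε hε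
  exact ⟨p, fun w hw => by rw [← h w hw]; exact hp w hw⟩

open Filter Topology in
lemma aux_PR_log (K : Set ℂ) (hK : IsCompact K) (hconn : IsConnected Kᶜ) (c : ℂ) (hc : c ∉ K) :
    AuxPR K (fun w => Real.log ‖w - c‖) := by
  have : CompactSpace K := isCompact_iff_compactSpace.1 hK
  have key : ∀ x ∈ Kᶜ, ∀ y ∈ Kᶜ, AuxPR K (fun w => Real.log ‖w - x‖ - Real.log ‖w - y‖) := by
    intro x hx y hy
    refine hconn.isPreconnected.induction₂
      (fun x y => AuxPR K (fun w => Real.log ‖w - x‖ - Real.log ‖w - y‖)) ?_ ?_ ?_ hx hy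
    · intro a ha
      obtain ⟨g, hg, hgw⟩ := aux_inv_mem K hconn a ha
      have hlim : Tendsto (fun b => ‖a - b‖ * ‖g‖) (𝓝[Kᶜ] a) (𝓝 0) := by
        have : Continuous (fun b => ‖a - b‖ * ‖g‖) := by fun_prop
        have := this.tendsto a
        simp only [sub_self, norm_zero, zero_mul] at this
        exact this.mono_left nhdsWithin_le_nhds
      filter_upwards [hlim.eventually (gt_mem_nhds (show (0:ℝ) < 1/2 by norm_num)),
        self_mem_nhdsWithin] with b hb hbK
      have h1 : ∀ w : K, ‖((a - b) • g) w‖ ≤ 1 / 2 := by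
        intro w
        rw [ContinuousMap.smul_apply, norm_smul]
        exact (mul_le_mul_of_nonneg_left (g.norm_coe_le_norm w) (norm_nonneg _)).trans hb.le
      have h2 : AuxPR K (fun w => Real.log ‖w - b‖ - Real.log ‖w - a‖) := by
        intro ε hε
        obtain ⟨p, hp⟩ := aux_log_A K _ ((AuxA K).smul_mem hg (a - b)) h1 ε hε
        refine ⟨p, fun w hw => ?_⟩
        have hp1 := hp ⟨w, hw⟩
        have hwa : w - a ≠ 0 := fun h => ha (by rw [sub_eq_zero] at h; rwa [← h])
        have hwb : w - b ≠ 0 := fun h => hbK (by rw [sub_eq_zero] at h; rwa [← h])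
        beta_reduce
        rw [← Real.log_div (norm_ne_zero_iff.2 hwb) (norm_ne_zero_iff.2 hwa), ← norm_div]
        have : (w - b) / (w - a) = 1 + ((a - b) • g) ⟨w, hw⟩ := by
          rw [ContinuousMap.smul_apply, hgw, smul_eq_mul]
          field_simp
          ring
        rw [this]; exact hp1
      exact aux_PR_congr (aux_PR_neg h2) fun w _ => by ring
    · intro a b d _ _ _ h1 h2
      exact aux_PR_congr (aux_PR_add h1 h2) fun w _ => by ring
    · intro a b _ _ h
      exact aux_PR_congr (aux_PR_neg h) fun w _ => by ring
  obtain ⟨M, hM0, hM⟩ := hK.isBounded.exists_pos_norm_le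
  let b : ℂ := ((2 * M : ℝ) : ℂ)
  have hbn : ‖b‖ = 2 * M := by simp [b, abs_of_pos hM0]
  have hb0 : b ≠ 0 := by rw [← norm_ne_zero_iff, hbn]; positivity
  have hbK : b ∈ Kᶜ := fun h => by
    have := hM b h
    rw [hbn] at this; linarith
  have hlog : AuxPR K (fun w => Real.log ‖w - b‖ - Real.log ‖b‖) := by
    intro ε hε
    have h1 : ∀ w : K, ‖((-b⁻¹) • auxId K) w‖ ≤ 1 / 2 := by
      intro w
      rw [ContinuousMap.smul_apply, norm_smul, norm_neg, norm_inv, hbn]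
      have := hM w w.2
      change (2 * M)⁻¹ * ‖(w:ℂ)‖ ≤ _
      rw [inv_mul_le_iff₀ (by positivity)]
      linarith
    obtain ⟨p, hp⟩ := aux_log_A K _ ((AuxA K).smul_mem (aux_id_mem K) (-b⁻¹)) h1 ε hε
    refine ⟨p, fun w hw => ?_⟩
    have hp1 := hp ⟨w, hw⟩
    have hwb : w - b ≠ 0 := fun h => hbK (by rw [sub_eq_zero] at h; rwa [← h])
    beta_reduce
    rw [← Real.log_div (norm_ne_zero_iff.2 hwb) (norm_ne_zero_iff.2 hb0), ← norm_div]
    have : ‖(w - b) / b‖ = ‖1 + ((-b⁻¹) • auxId K) ⟨w, hw⟩‖ := by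
      rw [ContinuousMap.smul_apply, smul_eq_mul, ← norm_neg]
      congr 1
      change _ = 1 + -b⁻¹ * w
      field_simp
      ring
    rw [this]; exact hp1
  exact aux_PR_congr (aux_PR_add (key c hc b hbK) (aux_PR_add hlog (aux_PR_const (Real.log ‖b‖))))
    fun w _ => by ring

lemma aux_circle (K : Set ℂ) (hK : IsCompact K) (hconn : IsConnected Kᶜ)
    (hempty : interior K = ∅) (a : ℂ) (r : ℝ) (hr : 0 < r) : ∃ c ∉ K, ‖c - a‖ = r := by
  by_contra hcon
  push Not at hcon
  have h1 : (Kᶜ ∩ Metric.ball a r).Nonempty := by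
    by_contra h
    rw [Set.not_nonempty_iff_eq_empty] at h
    have hsub : Metric.ball a r ⊆ K := by
      intro z hz
      by_contra hzK
      have : z ∈ Kᶜ ∩ Metric.ball a r := ⟨hzK, hz⟩
      rw [h] at this; exact this
    have := interior_maximal hsub Metric.isOpen_ball (Metric.mem_ball_self hr)
    rw [hempty] at this; exact this
  have h2 : (Kᶜ ∩ (Metric.closedBall a r)ᶜ).Nonempty := by
    have hb : Bornology.IsBounded (K ∪ Metric.closedBall a r) :=
      hK.isBounded.union Metric.isBounded_closedBall
    rw [← Set.compl_union]
    by_contra h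
    rw [Set.not_nonempty_iff_eq_empty, Set.compl_empty_iff] at h
    rw [h] at hb
    exact NormedSpace.unbounded_univ ℂ ℂ hb
  obtain ⟨z, _, hz1, hz2⟩ := hconn.isPreconnected (Metric.ball a r) (Metric.closedBall a r)ᶜ
    Metric.isOpen_ball Metric.isClosed_closedBall.isOpen_compl (by
      intro z hz
      have := hcon z hz
      rcases lt_trichotomy ‖z - a‖ r with h | h | h
      · left; simpa [dist_eq_norm] using h
      · exact absurd h this
      · right; simpa [dist_eq_norm] using h) h1 h2
  exact hz2 (Metric.ball_subset_closedBall hz1)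

open Filter Topology in
lemma aux_unif {E : Type*} [NormedAddCommGroup E] (F : ℂ → ℂ → E) (K : Set ℂ) (hK : IsCompact K)
    (z0 : ℂ) (h : ∀ w ∈ K, ContinuousAt (fun x : ℂ × ℂ => F x.1 x.2) (z0, w)) (η : ℝ) (hη : 0 < η) :
    ∀ᶠ z in 𝓝 z0, ∀ w ∈ K, ‖F z0 w - F z w‖ ≤ η := by
  refine hK.eventually_forall_of_forall_eventually fun w hw => ?_
  have h1 : ContinuousAt (fun x : ℂ × ℂ => F z0 x.2) (z0, w) := by
    have hc : ContinuousAt (fun x : ℂ × ℂ => ((z0, x.2) : ℂ × ℂ)) (z0, w) := by fun_prop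
    exact ContinuousAt.comp (f := fun x : ℂ × ℂ => ((z0, x.2) : ℂ × ℂ))
      (g := fun x : ℂ × ℂ => F x.1 x.2) (x := (z0, w)) (h w hw) hc
  have h2 : ContinuousAt (fun x : ℂ × ℂ => ‖F z0 x.2 - F x.1 x.2‖) (z0, w) := (h1.sub (h w hw)).norm
  have h3 := h2.eventually_lt (continuousAt_const (y := η)) (by simpa using hη)
  filter_upwards [h3] with x hx using hx.le

lemma aux_log_diff (x y r : ℝ) (hx : 0 < x) (hy : 0 < y) (hxy : |x - y| ≤ r) :
    |Real.log x - Real.log y| ≤ 2 * Real.sqrt r * (x ^ (-(1/2) : ℝ) + y ^ (-(1/2) : ℝ)) := by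
  have key : ∀ x y : ℝ, 0 < x → 0 < y → |x - y| ≤ r →
      Real.log x - Real.log y ≤ 2 * Real.sqrt r * y ^ (-(1/2) : ℝ) := by
    intro x y hx hy h
    have hr : 0 ≤ r := (abs_nonneg _).trans h
    have h1 : x ≤ y + r := by linarith [(abs_le.1 h).2]
    have h2 : Real.sqrt x ≤ Real.sqrt y + Real.sqrt r := by
      refine (Real.sqrt_le_sqrt h1).trans ?_
      rw [Real.sqrt_le_left (by positivity)]
      nlinarith [Real.sq_sqrt hy.le, Real.sq_sqrt hr, Real.sqrt_nonneg y, Real.sqrt_nonneg r,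
        mul_nonneg (Real.sqrt_nonneg y) (Real.sqrt_nonneg r)]
    have hsy : 0 < Real.sqrt y := Real.sqrt_pos.2 hy
    have hsx : 0 < Real.sqrt x := Real.sqrt_pos.2 hx
    have h3 : Real.log (Real.sqrt x / Real.sqrt y) ≤ Real.sqrt x / Real.sqrt y - 1 :=
      Real.log_le_sub_one_of_pos (by positivity)
    rw [Real.log_div hsx.ne' hsy.ne', Real.log_sqrt hx.le, Real.log_sqrt hy.le] at h3
    have h4 : Real.sqrt x / Real.sqrt y - 1 ≤ Real.sqrt r * (Real.sqrt y)⁻¹ := by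
      rw [← div_eq_mul_inv, div_sub_one hsy.ne']
      gcongr
      linarith
    rw [Real.rpow_neg hy.le, ← Real.sqrt_eq_rpow]
    linarith
  have a := key x y hx hy hxy
  have b := key y x hy hx (by rwa [abs_sub_comm])
  have c1 : 0 ≤ 2 * Real.sqrt r * x ^ (-(1/2) : ℝ) := by positivity
  have c2 : 0 ≤ 2 * Real.sqrt r * y ^ (-(1/2) : ℝ) := by positivity
  rw [abs_le, mul_add]
  constructor <;> linarith

lemma aux_abs_log (y L : ℝ) (hy : 0 ≤ y) (hL : y ≤ L) :
    |Real.log y| ≤ L + 2 * |y - 0| ^ (-(1/2) : ℝ) := by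
  rw [sub_zero, abs_of_nonneg hy]
  have c : 0 ≤ y ^ (-(1/2) : ℝ) := by positivity
  rcases hy.eq_or_lt with h | h
  · rw [← h]; rw [← h] at c; simp only [Real.log_zero, abs_zero]; linarith
  · rw [abs_le]
    constructor
    · have := Real.log_le_self c
      rw [Real.log_rpow h] at this
      linarith
    · have := Real.log_le_self hy
      linarith

lemma aux_ae_norm_ne (w : ℂ) (r : ℝ) : ∀ᵐ z : ℂ, ‖w - z‖ ≠ r := by
  have := MeasureTheory.Measure.addHaar_sphere (MeasureTheory.volume : MeasureTheory.Measure ℂ) w r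
  rw [MeasureTheory.ae_iff]
  convert this using 2
  ext z; simp [dist_eq_norm, norm_sub_rev]

/-- The real subspace of real parts of polynomials. -/
def auxSR : Submodule ℝ (ℂ → ℝ) where
  carrier := {f | ∃ p : Polynomial ℂ, ∀ w, f w = (p.eval w).re}
  add_mem' := by
    rintro f g ⟨p, hp⟩ ⟨q, hq⟩
    exact ⟨p + q, fun w => by simp [hp, hq]⟩
  zero_mem' := ⟨0, fun w => by simp⟩
  smul_mem' := by
    rintro c f ⟨p, hp⟩
    exact ⟨Polynomial.C (c : ℂ) * p, fun w => by simp [hp]⟩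

open MeasureTheory Set Filter Topology in
lemma aux_PR_sq (K : Set ℂ) (hK : IsCompact K) (hconn : IsConnected Kᶜ)
    (hempty : interior K = ∅) : AuxPR K (fun w => ‖w‖ ^ 2) := by
  obtain ⟨R, hR, hRK⟩ := hK.isBounded.exists_pos_norm_le
  obtain ⟨C, hC⟩ := aux_radial_half R hR
  have hC0 : 0 ≤ C := by
    refine le_trans ?_ (hC 0 le_rfl hR.le 0 (by simpa using hR.le)).2
    exact integral_nonneg fun z => Real.rpow_nonneg (abs_nonneg _) _
  have hlogint : ∀ w ∈ K, IntegrableOn (fun z => Real.log ‖w - z‖) (Metric.closedBall 0 R) := by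
    intro w hw
    have h1 := (hC 0 le_rfl hR.le w (hRK w hw)).1
    have h2 : IntegrableOn (fun z => 2 * R + 2 * |‖w - z‖ - 0| ^ (-(1/2) : ℝ))
        (Metric.closedBall 0 R) :=
      (integrableOn_const (isCompact_closedBall (0:ℂ) R).measure_lt_top.ne).add (h1.const_mul 2)
    refine Integrable.mono' h2 (Real.measurable_log.comp
      (by fun_prop : Measurable fun z : ℂ => ‖w - z‖)).aestronglyMeasurable ?_
    rw [ae_restrict_iff' Metric.isClosed_closedBall.measurableSet]
    refine Eventually.of_forall fun z hz => ?_
    rw [Real.norm_eq_abs]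
    refine aux_abs_log _ _ (norm_nonneg _) ?_
    have := norm_sub_le w z
    have := hRK w hw
    rw [mem_closedBall_zero_iff] at hz
    linarith
  intro ε hε
  set V := volume.real (Metric.closedBall (0:ℂ) R) with hV
  have hV0 : 0 ≤ V := measureReal_nonneg
  -- choose parameters
  set η : ℝ := ε / 2 / (V + 1) with hη
  have hη0 : 0 < η := by positivity
  set s : ℝ := ε / 2 / (4 * C + 1) with hs
  have hs0 : 0 < s := by positivity
  set r : ℝ := min R (s ^ 2) with hr
  have hr0 : 0 < r := by positivity
  have hrR : r ≤ R := min_le_left _ _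
  have hrs : Real.sqrt r ≤ s := by
    rw [Real.sqrt_le_left hs0.le]; exact min_le_right _ _
  let Er : ℂ → ℂ → ℝ := fun w z => η + 2 * Real.sqrt r *
    (|‖w - z‖ - r| ^ (-(1/2) : ℝ) + |‖w - z‖ - 0| ^ (-(1/2) : ℝ))
  have hEi : ∀ w ∈ K, IntegrableOn (Er w) (Metric.closedBall 0 R) := by
    intro w hw
    exact (integrableOn_const (isCompact_closedBall (0:ℂ) R).measure_lt_top.ne).add
      (((hC r hr0.le hrR w (hRK w hw)).1.add (hC 0 le_rfl hR.le w (hRK w hw)).1).const_mul _)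
  obtain ⟨P, ⟨p, hp⟩, hPK⟩ := aux_approx_integral (Metric.closedBall 0 R) K
    (isCompact_closedBall 0 R) (fun w z => Real.log ‖w - z‖) Er auxSR (by
      intro z0 hz0
      obtain ⟨c, hcK, hcr⟩ := aux_circle K hK hconn hempty z0 r hr0
      obtain ⟨p, hp⟩ := aux_PR_log K hK hconn c hcK (η / 2) (by positivity)
      have hun := aux_unif (fun z w => Real.log ‖w - z - (c - z0)‖) K hK z0 (by
        intro w hw
        have hne : ‖((z0, w) : ℂ × ℂ).2 - ((z0, w) : ℂ × ℂ).1 - (c - z0)‖ ≠ 0 := by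
          rw [norm_ne_zero_iff]
          intro h
          apply hcK
          have : w = c := by
            have h' : w - z0 - (c - z0) = 0 := h
            linear_combination h'
          rwa [← this]
        exact ContinuousAt.log (by fun_prop) hne) (η / 2) (by positivity)
      refine ⟨_, hun, fun w => (p.eval w).re, ⟨p, fun w => rfl⟩, fun w hw => ?_⟩
      filter_upwards [aux_ae_norm_ne w 0, aux_ae_norm_ne w r] with z hz1 hz2 hz3
      have hz3 := hz3 w hw
      have e : w - z0 - (c - z0) = w - c := by ring
      rw [e, Real.norm_eq_abs] at hz3
      have hp1 := hp w hw
      rw [abs_sub_comm] at hp1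
      set x := ‖w - z - (c - z0)‖ with hx
      set y := ‖w - z‖ with hy
      have hxl : |y - r| ≤ x := by
        rw [← hcr]
        exact abs_norm_sub_norm_le _ _
      have hxy : |x - y| ≤ r := by
        rw [← hcr, hx, hy]
        refine (abs_norm_sub_norm_le _ _).trans ?_
        rw [sub_sub_cancel_left, norm_neg]
      have hyp : 0 < y := lt_of_le_of_ne (norm_nonneg _) (Ne.symm hz1)
      have hyr : 0 < |y - r| := abs_pos.2 (sub_ne_zero.2 hz2)
      have hxp : 0 < x := hyr.trans_le hxl
      have h1 := aux_log_diff x y r hxp hyp hxy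
      have h2 : x ^ (-(1/2) : ℝ) ≤ |y - r| ^ (-(1/2) : ℝ) :=
        Real.rpow_le_rpow_of_nonpos hyr hxl (by norm_num)
      have h3 : 2 * Real.sqrt r * (x ^ (-(1/2) : ℝ) + y ^ (-(1/2) : ℝ)) ≤
          2 * Real.sqrt r * (|y - r| ^ (-(1/2) : ℝ) + |y - 0| ^ (-(1/2) : ℝ)) := by
        rw [sub_zero, abs_of_pos hyp]
        gcongr
      have hgoal : |(p.eval w).re - Real.log y| ≤ η + 2 * Real.sqrt r *
          (|y - r| ^ (-(1/2) : ℝ) + |y - 0| ^ (-(1/2) : ℝ)) := by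
        have t1 := abs_le.1 hp1
        have t2 := abs_le.1 hz3
        have t3 := abs_le.1 (h1.trans h3)
        rw [abs_le]
        constructor <;> linarith [t1.1, t1.2, t2.1, t2.2, t3.1, t3.2]
      exact hgoal) hlogint hEi
  refine ⟨Polynomial.C (((2 / Real.pi : ℝ)) : ℂ) *
    (p - Polynomial.C (((Real.pi * R ^ 2 * Real.log R - Real.pi / 2 * R ^ 2 : ℝ)) : ℂ)), ?_⟩
  intro w hw
  have h1 := hPK w hw
  rw [aux_log_potential w R hR (hRK w hw) (hlogint w hw), hp w] at h1
  have h2 : ∫ z in Metric.closedBall 0 R, Er w z ≤ ε := by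
    have a1 := hC r hr0.le hrR w (hRK w hw)
    have a2 := hC 0 le_rfl hR.le w (hRK w hw)
    have : ∫ z in Metric.closedBall 0 R, Er w z = V * η + 2 * Real.sqrt r *
      ((∫ z in Metric.closedBall 0 R, |‖w - z‖ - r| ^ (-(1/2) : ℝ)) +
        ∫ z in Metric.closedBall 0 R, |‖w - z‖ - 0| ^ (-(1/2) : ℝ)) := by
      have hi0 : Integrable (fun _ : ℂ => η) (volume.restrict (Metric.closedBall 0 R)) :=
        integrableOn_const (isCompact_closedBall (0:ℂ) R).measure_lt_top.ne
      have hi1 : Integrable (fun z : ℂ => 2 * Real.sqrt r *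
          (|‖w - z‖ - r| ^ (-(1/2) : ℝ) + |‖w - z‖ - 0| ^ (-(1/2) : ℝ)))
          (volume.restrict (Metric.closedBall 0 R)) := (a1.1.add a2.1).const_mul _
      have e1 : ∫ z in Metric.closedBall 0 R, Er w z =
          (∫ z in Metric.closedBall (0:ℂ) R, η) + ∫ z in Metric.closedBall 0 R, 2 * Real.sqrt r *
          (|‖w - z‖ - r| ^ (-(1/2) : ℝ) + |‖w - z‖ - 0| ^ (-(1/2) : ℝ)) := integral_add hi0 hi1
      rw [e1, integral_const_mul, integral_add a1.1 a2.1, setIntegral_const, smul_eq_mul]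
    rw [this]
    have b1 : V * η ≤ ε / 2 := by
      rw [hη, mul_div_assoc', div_le_iff₀ (by positivity)]
      nlinarith
    have b2 : 2 * Real.sqrt r *
      ((∫ z in Metric.closedBall 0 R, |‖w - z‖ - r| ^ (-(1/2) : ℝ)) +
        ∫ z in Metric.closedBall 0 R, |‖w - z‖ - 0| ^ (-(1/2) : ℝ)) ≤ 2 * s * (C + C) := by
      have := a1.2
      have := a2.2
      have hq : ∀ r : ℝ, 0 ≤ ∫ z in Metric.closedBall 0 R, |‖w - z‖ - r| ^ (-(1/2) : ℝ) :=
        fun r => integral_nonneg fun z => Real.rpow_nonneg (abs_nonneg _) _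
      have := hq r
      have := hq 0
      refine mul_le_mul (by linarith) (by linarith) (by linarith) (by linarith)
    have b3 : 2 * s * (C + C) ≤ ε / 2 := by
      have : s * (4 * C + 1) = ε / 2 := by rw [hs]; field_simp
      nlinarith
    linarith
  have h3 := h1.trans h2
  rw [Real.norm_eq_abs] at h3
  have e : ‖w‖ ^ 2 - (Polynomial.eval w (Polynomial.C (((2 / Real.pi : ℝ)) : ℂ) *
    (p - Polynomial.C (((Real.pi * R ^ 2 * Real.log R - Real.pi / 2 * R ^ 2 : ℝ)) : ℂ)))).re =
    - (2 / Real.pi) * ((p.eval w).re - (Real.pi / 2 * ‖w‖ ^ 2 +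
      (Real.pi * R ^ 2 * Real.log R - Real.pi / 2 * R ^ 2))) := by
    rw [Polynomial.eval_mul, Polynomial.eval_C, Complex.re_ofReal_mul, Polynomial.eval_sub,
      Polynomial.eval_C, Complex.sub_re, Complex.ofReal_re]
    have := Real.pi_pos
    field_simp
    ring
  rw [e, abs_mul, abs_neg, abs_of_pos (by positivity)]
  have hpi : 2 / Real.pi ≤ 1 := by
    rw [div_le_one Real.pi_pos]; linarith [Real.pi_gt_three]
  calc _ ≤ 1 * ε := mul_le_mul hpi h3 (abs_nonneg _) (by norm_num)
    _ = ε := one_mul _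

lemma aux_divdiff (F : Polynomial ℂ) : ∃ Q : ℂ → Polynomial ℂ,
    Continuous (fun x : ℂ × ℂ => (Q x.1).eval x.2) ∧
    ∀ z w, (w - z) * (Q z).eval w = F.eval w - F.eval z := by
  induction F using Polynomial.induction_on' with
  | add p q hp hq =>
    obtain ⟨P, hP1, hP2⟩ := hp
    obtain ⟨Q, hQ1, hQ2⟩ := hq
    refine ⟨fun z => P z + Q z, ?_, fun z w => ?_⟩
    · simp only [Polynomial.eval_add]
      exact hP1.add hQ1
    · simp only [Polynomial.eval_add]
      linear_combination hP2 z w + hQ2 z w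
  | monomial n a =>
    refine ⟨fun z => Polynomial.C a * ∑ i ∈ Finset.range n,
      Polynomial.X ^ i * Polynomial.C (z ^ (n - 1 - i)), ?_, fun z w => ?_⟩
    · simp only [Polynomial.eval_mul, Polynomial.eval_C, Polynomial.eval_finsetSum,
        Polynomial.eval_pow, Polynomial.eval_X]
      fun_prop
    · simp only [Polynomial.eval_mul, Polynomial.eval_C, Polynomial.eval_finsetSum,
        Polynomial.eval_pow, Polynomial.eval_X, Polynomial.eval_monomial]
      have := (Commute.all w z).geom_sum₂_mul n
      linear_combination a * this

/-- modulus bound for the compound-interest approximation of the exponential -/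
lemma aux_h_bound (x : ℂ) (M : ℕ) (hM : 0 < M) (a : ℝ) (hx : ‖x‖ ^ 2 ≤ M) (hre : x.re ≤ a) :
    ‖(1 + x / M) ^ M‖ ≤ Real.exp (a + 1) := by
  have hM' : (0 : ℝ) < M := by exact_mod_cast hM
  have h1 : ‖1 + x / M‖ ^ 2 ≤ Real.exp (2 * x.re / M + ‖x‖ ^ 2 / M ^ 2) := by
    have e : ‖1 + x / M‖ ^ 2 = 2 * x.re / M + ‖x‖ ^ 2 / M ^ 2 + 1 := by
      rw [← Complex.normSq_eq_norm_sq, ← Complex.normSq_eq_norm_sq, Complex.normSq_apply,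
        Complex.normSq_apply]
      simp only [Complex.add_re, Complex.one_re, Complex.div_natCast_re, Complex.add_im,
        Complex.one_im, Complex.div_natCast_im]
      field_simp
      ring
    rw [e]
    exact Real.add_one_le_exp _
  have h2 : (‖(1 + x / M) ^ M‖) ^ 2 ≤ (Real.exp (a + 1)) ^ 2 := by
    rw [norm_pow, ← pow_mul, mul_comm M 2, pow_mul]
    refine (pow_le_pow_left₀ (by positivity) h1 M).trans ?_
    rw [← Real.exp_nat_mul, ← Real.exp_nat_mul]
    apply Real.exp_le_exp.2
    have e : (M : ℝ) * (2 * x.re / M + ‖x‖ ^ 2 / M ^ 2) = 2 * x.re + ‖x‖ ^ 2 / M := by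
      field_simp
    rw [e]
    have : ‖x‖ ^ 2 / M ≤ 1 := by rwa [div_le_one hM']
    push_cast
    linarith
  exact (sq_le_sq₀ (norm_nonneg _) (Real.exp_pos _).le).1 h2

lemma aux_exp_bound (T s : ℝ) (hT : 0 < T) (hs : 0 < s) :
    Real.exp (-(T ^ 4 * s ^ 2)) / s ≤ 1 / T * s ^ (-(3/2) : ℝ) := by
  have hq : 0 < Real.sqrt s := Real.sqrt_pos.2 hs
  have h4 : (Real.sqrt s) ^ 4 = s ^ 2 := by
    rw [show (4:ℕ) = 2 * 2 from rfl, pow_mul, Real.sq_sqrt hs.le]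
  have h1 : T * Real.sqrt s ≤ Real.exp (T ^ 4 * s ^ 2) := by
    refine le_trans ?_ (Real.add_one_le_exp _)
    rw [← h4, ← mul_pow]
    set u := T * Real.sqrt s
    nlinarith [sq_nonneg (u ^ 2 - 1), sq_nonneg (u - 1)]
  have h2 : s ^ (-(3/2) : ℝ) = (s * Real.sqrt s)⁻¹ := by
    rw [Real.rpow_neg hs.le, show (3/2 : ℝ) = 1 + 1/2 by norm_num, Real.rpow_add hs,
      Real.rpow_one, ← Real.sqrt_eq_rpow]
  rw [h2, Real.exp_neg]
  have h3 : (Real.exp (T ^ 4 * s ^ 2))⁻¹ ≤ (T * Real.sqrt s)⁻¹ :=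
    inv_anti₀ (by positivity) h1
  calc _ ≤ (T * Real.sqrt s)⁻¹ / s := by gcongr
    _ = _ := by field_simp

/-- polynomial approximate Cauchy kernels -/
lemma aux_kernel (K : Set ℂ) (hK : IsCompact K) (hconn : IsConnected Kᶜ)
    (hempty : interior K = ∅) (R T : ℝ) (hT : 0 < T) :
    ∃ k : ℂ → Polynomial ℂ, Continuous (fun x : ℂ × ℂ => (k x.1).eval x.2) ∧
      ∀ z0 ∈ K, ∀ᶠ z in nhds z0, ‖z‖ ≤ R → ∀ w ∈ K, w ≠ z →
        ‖(k z).eval w - (w - z)⁻¹‖ ≤ Real.exp 4 / T * ‖w - z‖ ^ (-(3/2) : ℝ) := by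
  obtain ⟨F, hF⟩ := aux_PR_sq K hK hconn hempty (1 / T ^ 4) (by positivity)
  obtain ⟨Q, hQc, hQ⟩ := aux_divdiff F
  let q : ℂ → Polynomial ℂ := fun z =>
    Polynomial.C ((T : ℂ) ^ 4) * (Polynomial.C (2 * (starRingEnd ℂ) z) - Q z)
  have hqc : Continuous (fun x : ℂ × ℂ => (q x.1).eval x.2) := by
    simp only [q, Polynomial.eval_mul, Polynomial.eval_C, Polynomial.eval_sub]
    have : Continuous (fun x : ℂ × ℂ => (starRingEnd ℂ) x.1) :=
      Complex.continuous_conj.comp continuous_fst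
    fun_prop
  have hqe : ∀ z w, (w - z) * (q z).eval w = (T : ℂ) ^ 4 *
      (2 * (starRingEnd ℂ) z * (w - z) - F.eval w + F.eval z) := by
    intro z w
    simp only [q, Polynomial.eval_mul, Polynomial.eval_C, Polynomial.eval_sub]
    linear_combination (-(T : ℂ) ^ 4) * hQ z w
  have hxc : Continuous (fun x : ℂ × ℂ => (x.2 - x.1) * (q x.1).eval x.2) := by fun_prop
  obtain ⟨B, hB⟩ := ((isCompact_closedBall (0:ℂ) R).prod hK).exists_bound_of_continuousOn
    hxc.continuousOn
  obtain ⟨M0, hM0⟩ := exists_nat_ge (B ^ 2)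
  set M := M0 + 1 with hM
  have hMpos : 0 < M := Nat.succ_pos _
  have hMc : (M : ℂ) ≠ 0 := by exact_mod_cast hMpos.ne'
  let k : ℂ → Polynomial ℂ := fun z => - (Polynomial.C ((M : ℂ)⁻¹) * q z *
    ∑ j ∈ Finset.range M, (1 + Polynomial.C ((M : ℂ)⁻¹) * ((Polynomial.X - Polynomial.C z) * q z)) ^ j)
  have hke : ∀ z w, (k z).eval w = - ((M : ℂ)⁻¹ * (q z).eval w *
      ∑ j ∈ Finset.range M, (1 + (M : ℂ)⁻¹ * ((w - z) * (q z).eval w)) ^ j) := by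
    intro z w
    simp only [k, Polynomial.eval_neg, Polynomial.eval_mul, Polynomial.eval_C,
      Polynomial.eval_finsetSum, Polynomial.eval_pow, Polynomial.eval_add, Polynomial.eval_one,
      Polynomial.eval_sub, Polynomial.eval_X]
  have hkd : ∀ z w, (w - z) * (k z).eval w = 1 - (1 + ((w - z) * (q z).eval w) / M) ^ M := by
    intro z w
    rw [hke]
    have := mul_geom_sum (1 + (M : ℂ)⁻¹ * ((w - z) * (q z).eval w)) M
    rw [div_eq_inv_mul]
    linear_combination -this
  refine ⟨k, ?_, ?_⟩
  · simp only [hke]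
    fun_prop
  · intro z0 hz0
    have hev : ∀ᶠ z in nhds z0, (F.eval z).re - ‖z‖ ^ 2 < 2 * (1 / T ^ 4) := by
      have hc : Continuous (fun z : ℂ => (F.eval z).re - ‖z‖ ^ 2) := by
        have := Complex.continuous_re.comp F.continuous
        exact this.sub (by fun_prop)
      refine hc.continuousAt.eventually_lt continuousAt_const ?_
      have := (abs_le.1 (hF z0 hz0)).1
      have hp : 0 < 1 / T ^ 4 := by positivity
      linarith
    filter_upwards [hev] with z hz hzR w hw hne
    have hsub : w - z ≠ 0 := sub_ne_zero.2 hne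
    have hs : 0 < ‖w - z‖ := norm_pos_iff.2 hsub
    set x := (w - z) * (q z).eval w with hx
    have hxM : ‖x‖ ^ 2 ≤ M := by
      have := hB (z, w) ⟨by simpa using hzR, hw⟩
      have h2 : ‖x‖ ^ 2 ≤ B ^ 2 := pow_le_pow_left₀ (norm_nonneg _) this 2
      rw [hM]; push_cast; linarith
    have hxre : x.re ≤ 3 - T ^ 4 * ‖w - z‖ ^ 2 := by
      have e1 : x.re = T ^ 4 * ((2 * (starRingEnd ℂ) z * (w - z)).re - (F.eval w).re
          + (F.eval z).re) := by
        rw [hx, hqe, ← Complex.ofReal_pow, Complex.re_ofReal_mul]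
        simp
      have e2 : (2 * (starRingEnd ℂ) z * (w - z)).re =
          ‖w‖ ^ 2 - ‖z‖ ^ 2 - ‖w - z‖ ^ 2 := by
        rw [← Complex.normSq_eq_norm_sq, ← Complex.normSq_eq_norm_sq, ← Complex.normSq_eq_norm_sq,
          Complex.normSq_apply, Complex.normSq_apply, Complex.normSq_apply]
        simp
        ring
      have h1 := (abs_le.1 (hF w hw)).2
      have h3 : (2 * (starRingEnd ℂ) z * (w - z)).re - (F.eval w).re + (F.eval z).re ≤
          3 * (1 / T ^ 4) - ‖w - z‖ ^ 2 := by
        rw [e2]; linarith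
      have h4 : (0:ℝ) ≤ T ^ 4 := by positivity
      have h5 := mul_le_mul_of_nonneg_left h3 h4
      rw [e1]
      refine h5.trans (le_of_eq ?_)
      field_simp
    have hb := aux_h_bound x M hMpos _ hxM hxre
    have e : (k z).eval w - (w - z)⁻¹ = - (1 + x / M) ^ M * (w - z)⁻¹ := by
      have h6 : (w - z) * (k z).eval w = 1 - (1 + x / M) ^ M := hkd z w
      generalize (1 + x / M) ^ M = y at h6 ⊢
      field_simp
      linear_combination h6
    rw [e, norm_mul, norm_neg, norm_inv, ← div_eq_mul_inv]
    calc _ ≤ Real.exp (3 - T ^ 4 * ‖w - z‖ ^ 2 + 1) / ‖w - z‖ := by gcongr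
      _ = Real.exp 4 * (Real.exp (-(T ^ 4 * ‖w - z‖ ^ 2)) / ‖w - z‖) := by
        rw [mul_div_assoc', ← Real.exp_add]; congr 2; ring
      _ ≤ Real.exp 4 * (1 / T * ‖w - z‖ ^ (-(3/2) : ℝ)) := by
        gcongr; exact aux_exp_bound T _ hT hs
      _ = _ := by ring

/-- The real subspace of polynomial functions. -/
def auxSC : Submodule ℝ (ℂ → ℂ) where
  carrier := {f | ∃ p : Polynomial ℂ, ∀ w, f w = p.eval w}
  add_mem' := by
    rintro f g ⟨p, hp⟩ ⟨q, hq⟩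
    exact ⟨p + q, fun w => by simp [hp, hq]⟩
  zero_mem' := ⟨0, fun w => by simp⟩
  smul_mem' := by
    rintro c f ⟨p, hp⟩
    exact ⟨Polynomial.C (c : ℂ) * p, fun w => by simp [hp]⟩

open MeasureTheory Set Filter Topology in
lemma aux_conj (K : Set ℂ) (hK : IsCompact K) (hconn : IsConnected Kᶜ)
    (hempty : interior K = ∅) (ε : ℝ) (hε : 0 < ε) :
    ∃ p : Polynomial ℂ, ∀ w ∈ K, ‖(starRingEnd ℂ) w - p.eval w‖ ≤ ε := by
  have : CompactSpace K := isCompact_iff_compactSpace.1 hK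
  obtain ⟨R, hR, hRK⟩ := hK.isBounded.exists_pos_norm_le
  obtain ⟨C, hC⟩ := aux_radial_three_half R hR
  have hC0 : 0 ≤ C := by
    refine le_trans ?_ (hC 0 (by simpa using hR.le)).2
    exact integral_nonneg fun z => Real.rpow_nonneg (norm_nonneg _) _
  have hconst : ∀ η : ℝ, Integrable (fun _ : ℂ => η) (volume.restrict (Metric.closedBall 0 R)) :=
    fun η => integrableOn_const (isCompact_closedBall (0:ℂ) R).measure_lt_top.ne
  have hinvint : ∀ w ∈ K, IntegrableOn (fun z => (w - z)⁻¹) (Metric.closedBall 0 R) := by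
    intro w hw
    have h1 := (hC w (hRK w hw)).1
    refine Integrable.mono' (h1.const_mul (Real.sqrt (2 * R)))
      (by fun_prop : Measurable fun z : ℂ => (w - z)⁻¹).aestronglyMeasurable ?_
    rw [ae_restrict_iff' Metric.isClosed_closedBall.measurableSet]
    refine Eventually.of_forall fun z hz => ?_
    rw [norm_inv]
    rcases (norm_nonneg (w - z)).eq_or_lt with h | h
    · rw [← h, _root_.inv_zero]; positivity
    · have h2 : ‖w - z‖ ≤ 2 * R := by
        have := norm_sub_le w z
        have := hRK w hw
        rw [mem_closedBall_zero_iff] at hz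
        linarith
      set s := ‖w - z‖
      have e : s ^ (-(3/2) : ℝ) = (s * Real.sqrt s)⁻¹ := by
        rw [Real.rpow_neg h.le, show (3/2 : ℝ) = 1 + 1/2 by norm_num, Real.rpow_add h,
          Real.rpow_one, ← Real.sqrt_eq_rpow]
      have hq : 0 < Real.sqrt s := Real.sqrt_pos.2 h
      rw [e, mul_inv]
      have h3 : 1 ≤ Real.sqrt (2 * R) * (Real.sqrt s)⁻¹ := by
        rw [← div_eq_mul_inv, one_le_div hq]
        exact Real.sqrt_le_sqrt h2
      have h4 : 0 < s⁻¹ := by positivity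
      nlinarith
  set V := volume.real (Metric.closedBall (0:ℂ) R) with hV
  have hV0 : 0 ≤ V := measureReal_nonneg
  set η : ℝ := ε / 2 / (V + 1) with hη
  have hη0 : 0 < η := by positivity
  set T : ℝ := Real.exp 4 * (C + 1) * (2 / ε) with hTdef
  have hT : 0 < T := by positivity
  set D : ℝ := Real.exp 4 / T with hD
  have hD0 : 0 < D := by positivity
  have hDC : D * C ≤ ε / 2 := by
    have : D * (C + 1) = ε / 2 := by rw [hD, hTdef]; field_simp
    nlinarith
  obtain ⟨k, hkc, hk⟩ := aux_kernel K hK hconn hempty (R + 1) T hT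
  let Er : ℂ → ℂ → ℝ := fun w z => η + D * ‖w - z‖ ^ (-(3/2) : ℝ)
  have hEi : ∀ w ∈ K, IntegrableOn (Er w) (Metric.closedBall 0 R) := by
    intro w hw
    exact (hconst η).add ((hC w (hRK w hw)).1.const_mul _)
  obtain ⟨P, ⟨p, hp⟩, hPK⟩ := aux_approx_integral (Metric.closedBall 0 R) K
    (isCompact_closedBall 0 R) (fun w z => (w - z)⁻¹) Er auxSC (by
      intro z0 hz0
      by_cases hzK : z0 ∈ K
      · have hun := aux_unif (fun z w => (k z).eval w) K hK z0
          (fun w hw => hkc.continuousAt) η hη0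
        have hn : ∀ᶠ z in 𝓝 z0, ‖z‖ ≤ R + 1 := by
          have hc : Continuous (fun z : ℂ => ‖z‖) := continuous_norm
          refine (hc.continuousAt.eventually_lt (continuousAt_const (y := R + 1)) ?_).mono
            fun z hz => le_of_lt hz
          rw [mem_closedBall_zero_iff] at hz0
          linarith
        refine ⟨_, (hun.and (hn.and (hk z0 hzK))), fun w => (k z0).eval w,
          ⟨k z0, fun w => rfl⟩, fun w hw => ?_⟩
        filter_upwards [aux_ae_norm_ne w 0] with z hz1 hz
        obtain ⟨a1, a2, a3⟩ := hz
        have hne : w ≠ z := by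
          intro h; apply hz1; rw [h]; simp
        have b1 := a1 w hw
        have b2 := a3 a2 w hw hne
        have e : (k z0).eval w - (w - z)⁻¹ =
          ((k z0).eval w - (k z).eval w) + ((k z).eval w - (w - z)⁻¹) := by ring
        change ‖(k z0).eval w - (w - z)⁻¹‖ ≤ η + D * ‖w - z‖ ^ (-(3/2) : ℝ)
        rw [e]
        exact (norm_add_le _ _).trans (add_le_add b1 b2)
      · obtain ⟨g, hg, hge⟩ := aux_inv_mem K hconn z0 hzK
        obtain ⟨p, hp⟩ := (aux_mem_A K g).1 hg (η / 2) (by positivity)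
        have hun := aux_unif (fun z w => (w - z)⁻¹) K hK z0 (by
          intro w hw
          refine ContinuousAt.inv₀ (by fun_prop) ?_
          intro h
          have h' : w - z0 = 0 := h
          rw [sub_eq_zero] at h'
          exact hzK (h' ▸ hw)) (η / 2) (by positivity)
        refine ⟨_, hun, fun w => p.eval w, ⟨p, fun w => rfl⟩, fun w hw => ?_⟩
        refine Eventually.of_forall fun z hz => ?_
        have b1 := hz w hw
        have b2 := hp ⟨w, hw⟩
        rw [hge, norm_sub_rev] at b2
        have e : p.eval w - (w - z)⁻¹ =
          (p.eval w - (w - z0)⁻¹) + ((w - z0)⁻¹ - (w - z)⁻¹) := by ring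
        change ‖p.eval w - (w - z)⁻¹‖ ≤ η + D * ‖w - z‖ ^ (-(3/2) : ℝ)
        have c : 0 ≤ D * ‖w - z‖ ^ (-(3/2) : ℝ) := by positivity
        rw [e]
        refine (norm_add_le _ _).trans ?_
        have b2' : ‖p.eval w - (w - z0)⁻¹‖ ≤ η / 2 := b2
        linarith) hinvint hEi
  refine ⟨Polynomial.C ((Real.pi : ℂ)⁻¹) * p, fun w hw => ?_⟩
  have h1 := hPK w hw
  rw [aux_cauchy_potential w R hR (hRK w hw) (hinvint w hw), hp w] at h1
  have h2 : ∫ z in Metric.closedBall 0 R, Er w z ≤ ε := by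
    have a1 := hC w (hRK w hw)
    have e1 : ∫ z in Metric.closedBall 0 R, Er w z =
          (∫ z in Metric.closedBall (0:ℂ) R, η) + ∫ z in Metric.closedBall 0 R,
            D * ‖w - z‖ ^ (-(3/2) : ℝ) := integral_add (hconst η) (a1.1.const_mul D)
    rw [e1, integral_const_mul, setIntegral_const, smul_eq_mul, ← hV]
    have b1 : V * η ≤ ε / 2 := by
      rw [hη, mul_div_assoc', div_le_iff₀ (by positivity)]
      nlinarith
    have b2 := mul_le_mul_of_nonneg_left a1.2 hD0.le
    linarith
  have h3 := h1.trans h2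
  have hpi : (Real.pi : ℂ) ≠ 0 := by exact_mod_cast Real.pi_ne_zero
  have e : (starRingEnd ℂ) w - (Polynomial.C ((Real.pi : ℂ)⁻¹) * p).eval w =
      -((Real.pi : ℂ)⁻¹ * (p.eval w - Real.pi * (starRingEnd ℂ) w)) := by
    rw [Polynomial.eval_mul, Polynomial.eval_C]
    field_simp
    ring
  rw [e, norm_neg, norm_mul, norm_inv, Complex.norm_real, Real.norm_eq_abs,
    abs_of_pos Real.pi_pos]
  have hpi1 : Real.pi⁻¹ ≤ 1 := inv_le_one_of_one_le₀ (by linarith [Real.pi_gt_three])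
  calc _ ≤ 1 * ε := mul_le_mul hpi1 h3 (norm_nonneg _) (by norm_num)
    _ = ε := one_mul _

/-- Lavrentiev theorem. -/
lemma aux_lavrentiev (K : Set ℂ) (hK : IsCompact K) [CompactSpace K] (hconn : IsConnected Kᶜ)
    (hempty : interior K = ∅) (f : C(K, ℂ)) (ε : ℝ) (hε : 0 < ε) :
    ∃ p : Polynomial ℂ, ∀ w : K, ‖f w - p.eval (w : ℂ)‖ ≤ ε := by
  have hmem : f ∈ AuxA K := by
    induction f using ContinuousMap.induction_on_of_compact with
    | const r => exact (AuxA K).algebraMap_mem r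
    | id => exact aux_id_mem K
    | star_id =>
      rw [aux_mem_A]
      intro ε hε
      obtain ⟨p, hp⟩ := aux_conj K hK hconn hempty ε hε
      exact ⟨p, fun w => hp w w.2⟩
    | add f g hf hg => exact (AuxA K).add_mem hf hg
    | mul f g hf hg => exact (AuxA K).mul_mem hf hg
    | frequently f hf => exact (aux_A_closed K).mem_of_frequently_of_tendsto hf Filter.tendsto_id
  exact (aux_mem_A K f).1 hmem ε hε

open Topology Filter in
lemma aux_posdef_open {X : Type*} [TopologicalSpace X] (n : ℕ) (A : X → Matrix (Fin n) (Fin n) ℂ)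
    (hA : Continuous A) (hh : ∀ x, (A x).IsHermitian) (x0 : X) (h0 : (A x0).PosDef) :
    ∀ᶠ x in 𝓝 x0, (A x).PosDef := by
  have hev : ∀ᶠ x in 𝓝 x0, ∀ v ∈ Metric.sphere (0 : Fin n → ℂ) 1,
      0 < (star v ⬝ᵥ (A x) *ᵥ v).re := by
    refine (isCompact_sphere (0 : Fin n → ℂ) 1).eventually_forall_of_forall_eventually
      fun v hv => ?_
    have hc : Continuous (fun y : X × (Fin n → ℂ) => (star y.2 ⬝ᵥ (A y.1) *ᵥ y.2).re) := by
      refine Complex.continuous_re.comp ?_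
      exact Continuous.dotProduct (by fun_prop)
        (Continuous.matrix_mulVec (hA.comp continuous_fst) continuous_snd)
    refine continuousAt_const.eventually_lt hc.continuousAt ?_
    have hv0 : v ≠ 0 := by
      rintro rfl
      simp at hv
    exact (Complex.pos_iff.1 (h0.dotProduct_mulVec_pos hv0)).1
  filter_upwards [hev] with x hx
  refine Matrix.PosDef.of_dotProduct_mulVec_pos (hh x) fun v hv => ?_
  have him : (star v ⬝ᵥ (A x) *ᵥ v).im = 0 := (hh x).im_star_dotProduct_mulVec_self v
  refine Complex.pos_iff.2 ⟨?_, him.symm⟩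
  have hn : 0 < ‖v‖ := norm_pos_iff.2 hv
  have h1 := hx ((‖v‖⁻¹ : ℝ) • v) (by
    rw [mem_sphere_zero_iff_norm, norm_smul, norm_inv, norm_norm, inv_mul_cancel₀ hn.ne'])
  have e : star ((‖v‖⁻¹ : ℝ) • v) ⬝ᵥ (A x) *ᵥ ((‖v‖⁻¹ : ℝ) • v) =
      (‖v‖⁻¹ * ‖v‖⁻¹ : ℝ) • (star v ⬝ᵥ (A x) *ᵥ v) := by
    rw [star_smul, star_trivial, Matrix.mulVec_smul, dotProduct_smul, smul_dotProduct, smul_smul]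
  rw [e, Complex.smul_re, smul_eq_mul] at h1
  exact (pos_iff_pos_of_mul_pos h1).1 (by positivity)

/-- The affine family. -/
noncomputable def auxG {n p : ℕ} (G0 : ℂ → Matrix (Fin n) (Fin n) ℂ)
    (G : Fin p → ℂ → Matrix (Fin n) (Fin n) ℂ) (δ : ℂ) (x : Fin p → ℂ) :
    Matrix (Fin n) (Fin n) ℂ :=
  G0 δ + ∑ i, (x i • G i δ + (starRingEnd ℂ) (x i) • (G i δ)ᴴ)

lemma auxG_herm {n p : ℕ} (G0 : ℂ → Matrix (Fin n) (Fin n) ℂ)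
    (G : Fin p → ℂ → Matrix (Fin n) (Fin n) ℂ) (δ : ℂ) (x : Fin p → ℂ)
    (h : (G0 δ).IsHermitian) : (auxG G0 G δ x).IsHermitian := by
  unfold Matrix.IsHermitian auxG
  rw [Matrix.conjTranspose_add, h.eq, Matrix.conjTranspose_sum]
  congr 1
  refine Finset.sum_congr rfl fun i _ => ?_
  rw [Matrix.conjTranspose_add, Matrix.conjTranspose_smul, Matrix.conjTranspose_smul,
    Matrix.conjTranspose_conjTranspose, add_comm]
  simp

lemma auxG_convex {n p : ℕ} (G0 : ℂ → Matrix (Fin n) (Fin n) ℂ)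
    (G : Fin p → ℂ → Matrix (Fin n) (Fin n) ℂ) (δ : ℂ) :
    Convex ℝ {x | (auxG G0 G δ x).PosDef} := by
  rw [convex_iff_forall_pos]
  intro x hx y hy a b ha hb hab
  have e : auxG G0 G δ (a • x + b • y) = a • auxG G0 G δ x + b • auxG G0 G δ y := by
    unfold auxG
    have e0 : G0 δ = a • G0 δ + b • G0 δ := by rw [← add_smul, hab, one_smul]
    rw [smul_add, smul_add, Finset.smul_sum, Finset.smul_sum, add_add_add_comm, ← e0,
      ← Finset.sum_add_distrib]
    congr 1
    refine Finset.sum_congr rfl fun i _ => ?_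
    ext j k
    simp
    ring
  change (auxG G0 G δ (a • x + b • y)).PosDef
  rw [e]
  exact (Matrix.PosDef.smul hx ha).add (Matrix.PosDef.smul hy hb)

/-- second part of Theorem `th:ours`, via Mergelyan's theorem:
for one complex parameter ranging over a nonempty compact set `K ⊆ ℂ` with
connected complement and empty interior, a pointwise feasible
complex-parameter-dependent LMI admits a solution which is polynomial in `δ`. -/
theorem stmt6 (n p : ℕ) (hn : 0 < n) (hp : 0 < p)
    (K : Set ℂ) (hK : IsCompact K) (hKne : K.Nonempty)
    (hKconn : IsConnected Kᶜ) (hKint : interior K = ∅)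
    (G0 : ℂ → Matrix (Fin n) (Fin n) ℂ)
    (G : Fin p → ℂ → Matrix (Fin n) (Fin n) ℂ)
    (hG0c : ContinuousOn G0 K) (hG0h : ∀ δ ∈ K, (G0 δ).IsHermitian)
    (hGc : ∀ i, ContinuousOn (G i) K)
    (hfeas : ∀ δ ∈ K, ∃ x : Fin p → ℂ,
      (G0 δ + ∑ i, (x i • G i δ + (starRingEnd ℂ) (x i) • (G i δ)ᴴ)).PosDef) :
    ∃ q : Fin p → Polynomial ℂ,
      ∀ δ ∈ K,
        (G0 δ + ∑ i, ((q i).eval δ • G i δ +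
          (starRingEnd ℂ) ((q i).eval δ) • (G i δ)ᴴ)).PosDef := by
  have hcs : CompactSpace K := isCompact_iff_compactSpace.1 hK
  let A : K × (Fin p → ℂ) → Matrix (Fin n) (Fin n) ℂ := fun y => auxG G0 G y.1 y.2
  have hAc : Continuous A := by
    have h0 : Continuous (fun y : K × (Fin p → ℂ) => G0 y.1) :=
      (continuousOn_iff_continuous_restrict.1 hG0c).comp continuous_fst
    have h1 : ∀ i, Continuous (fun y : K × (Fin p → ℂ) => G i y.1) := fun i =>
      (continuousOn_iff_continuous_restrict.1 (hGc i)).comp continuous_fst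
    have h2 : ∀ i, Continuous (fun y : K × (Fin p → ℂ) => y.2 i) := fun i => by fun_prop
    refine h0.add (continuous_finsetSum _ fun i _ => ?_)
    exact ((h2 i).smul (h1 i)).add
      ((Complex.continuous_conj.comp (h2 i)).smul (h1 i).matrix_conjTranspose)
  have hAh : ∀ y, (A y).IsHermitian := fun y => auxG_herm G0 G y.1 y.2 (hG0h y.1 y.1.2)
  obtain ⟨f, hf⟩ := exists_continuous_forall_mem_convex_of_local_const
    (X := K) (E := Fin p → ℂ) (t := fun δ => {x | (auxG G0 G δ x).PosDef})
    (fun δ => auxG_convex G0 G δ) (by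
      intro δ
      obtain ⟨x, hx⟩ := hfeas δ δ.2
      refine ⟨x, ?_⟩
      exact aux_posdef_open n (fun δ' : K => A (δ', x)) (by fun_prop) (fun δ' => hAh _) δ hx)
  have hev : ∀ᶠ y in nhds (0 : Fin p → ℂ), ∀ δ ∈ (Set.univ : Set K),
      (A (δ, f δ + y)).PosDef := by
    refine isCompact_univ.eventually_forall_of_forall_eventually fun δ _ => ?_
    refine aux_posdef_open n (fun z : (Fin p → ℂ) × K => A (z.2, f z.2 + z.1))
      (by fun_prop) (fun z => hAh _) (0, δ) ?_
    simpa using hf δ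
  obtain ⟨ε, hε, hball⟩ := Metric.eventually_nhds_iff.1 hev
  have happ : ∀ i, ∃ q : Polynomial ℂ, ∀ δ : K, ‖f δ i - q.eval (δ : ℂ)‖ ≤ ε / 2 := fun i =>
    aux_lavrentiev K hK hKconn hKint ⟨fun δ => f δ i, by fun_prop⟩ (ε / 2) (by positivity)
  choose q hq using happ
  refine ⟨q, fun δ hδ => ?_⟩
  have := @hball (fun i => (q i).eval δ - f ⟨δ, hδ⟩ i) (by
    rw [dist_zero_right]
    refine lt_of_le_of_lt ((pi_norm_le_iff_of_nonneg (by positivity : 0 ≤ ε / 2)).2 fun i => ?_)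
      (by linarith)
    rw [norm_sub_rev]
    exact hq i ⟨δ, hδ⟩) ⟨δ, hδ⟩ (Set.mem_univ _)
  have e : f ⟨δ, hδ⟩ + (fun i => (q i).eval δ - f ⟨δ, hδ⟩ i) = fun i => (q i).eval δ := by
    ext i; simp
  rw [e] at this
  exact this
end

section
/- Let K ⊆ ℂ^m be a nonempty compact set, let G_0 : K → ℂ^{n×n} be a continuous map taking Hermitian values, let G_1, …, G_p : K → ℂ^{n×n} be continuous, and for x ∈ ℂ^p, δ ∈ K define the Hermitian matrix G(x, δ) = G_0(δ) + Σ_{i=1}^p (x_i G_i(δ) + conj(x_i) G_i(δ)*). If for every δ ∈ K there exists x(δ) ∈ ℂ^p such that G(x(δ), δ) is positive definite, then there exist nonnegative integers q_1, …, q_m, with N = 2(q_1 + … + q_m), complex matrices A* , E* ∈ ℂ^{N×N}, vectors/matrices B*, F* ∈ ℂ^{N×1}, C* ∈ ℂ^{p×N}, D* ∈ ℂ^{p×1}, such that, writing Δ(δ) = diag(δ_1 I_{q_1}, …, δ_m I_{q_m}) and Δ̄(δ) = diag(Δ(δ), Δ(δ)*) = diag(δ_1 I_{q_1}, …, δ_m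 I_{q_m}, conj(δ_1) I_{q_1}, …, conj(δ_m) I_{q_m}): (a) E* − Δ̄(δ) A* is invertible for every δ ∈ K, and (b) the function x^*(δ) = D* + C* (E* − Δ̄(δ) A*)^{-1} (Δ̄(δ) B* − F*) satisfies that G(x^*(δ), δ) is positive definite for every δ ∈ K. -/
open Matrix
open scoped ComplexOrder

/-- the evaluation of a letter -/
def letterVal {m : ℕ} (δ : Fin m → ℂ) : Fin m ⊕ Fin m → ℂ :=
  Sum.elim δ (fun i => (starRingEnd ℂ) (δ i))

def wordVal {m : ℕ} (δ : Fin m → ℂ) (w : List (Fin m ⊕ Fin m)) : ℂ :=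
  (w.map (letterVal δ)).prod

theorem realize (m p : ℕ) (c : Fin p → List (Fin m ⊕ Fin m) →₀ ℂ) :
    ∃ q : Fin m → ℕ,
    ∃ A E : Matrix ((Σ i : Fin m, Fin (q i)) ⊕ (Σ i : Fin m, Fin (q i)))
        ((Σ i : Fin m, Fin (q i)) ⊕ (Σ i : Fin m, Fin (q i))) ℂ,
    ∃ B F : Matrix ((Σ i : Fin m, Fin (q i)) ⊕ (Σ i : Fin m, Fin (q i))) (Fin 1) ℂ,
    ∃ C : Matrix (Fin p) ((Σ i : Fin m, Fin (q i)) ⊕ (Σ i : Fin m, Fin (q i))) ℂ,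
    ∃ D : Matrix (Fin p) (Fin 1) ℂ,
      ∀ δ : Fin m → ℂ,
        IsUnit (E - Matrix.diagonal
            (Sum.elim (fun a : Σ i : Fin m, Fin (q i) => δ a.1)
              (fun a : Σ i : Fin m, Fin (q i) => (starRingEnd ℂ) (δ a.1))) * A) ∧
        ∀ i, (D + C * (E - Matrix.diagonal
              (Sum.elim (fun a : Σ i : Fin m, Fin (q i) => δ a.1)
                (fun a : Σ i : Fin m, Fin (q i) => (starRingEnd ℂ) (δ a.1))) * A)⁻¹ *
            (Matrix.diagonal
              (Sum.elim (fun a : Σ i : Fin m, Fin (q i) => δ a.1)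
                (fun a : Σ i : Fin m, Fin (q i) => (starRingEnd ℂ) (δ a.1))) * B - F)) i 0
          = (c i).sum (fun w a => a * wordVal δ w) := by
  classical
  obtain ⟨d, hd⟩ : ∃ d : ℕ, ∀ i, ∀ w ∈ (c i).support, w.length ≤ d := by
    refine ⟨(Finset.univ.biUnion fun i => (c i).support).sup List.length, fun i w hw => ?_⟩
    exact Finset.le_sup (f := List.length)
      (Finset.mem_biUnion.2 ⟨i, Finset.mem_univ _, hw⟩)
  let W := {l : List (Fin m ⊕ Fin m) // l.length < d}
  have : Finite W := (List.finite_length_lt (Fin m ⊕ Fin m) d).to_subtype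
  let Q := Nat.card W
  let e : W ≃ Fin Q := Finite.equivFin W
  let q : Fin m → ℕ := fun _ => Q
  let J := (Σ i : Fin m, Fin (q i)) ⊕ (Σ i : Fin m, Fin (q i))
  let lab : J → Fin m ⊕ Fin m := Sum.elim (fun a => Sum.inl a.1) (fun a => Sum.inr a.1)
  let tl : J → List (Fin m ⊕ Fin m) :=
    Sum.elim (fun a => (e.symm a.2).1) (fun a => (e.symm a.2).1)
  have htl : ∀ a, (tl a).length < d := by
    rintro (a | a)
    · exact (e.symm a.2).2
    · exact (e.symm a.2).2
  let word : J → List (Fin m ⊕ Fin m) := fun a => lab a :: tl a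
  have hinj : Function.Injective word := by
    intro a b hab
    have h1 : lab a = lab b := (List.cons.inj hab).1
    have h2 : tl a = tl b := (List.cons.inj hab).2
    rcases a with ⟨a1, a2⟩ | ⟨a1, a2⟩ <;> rcases b with ⟨b1, b2⟩ | ⟨b1, b2⟩
    · have h3 : a1 = b1 := Sum.inl.inj h1
      have h4 : a2 = b2 := e.symm.injective (Subtype.ext h2)
      subst h3; subst h4; rfl
    · exact absurd h1 (by simp [lab])
    · exact absurd h1 (by simp [lab])
    · have h3 : a1 = b1 := Sum.inr.inj h1
      have h4 : a2 = b2 := e.symm.injective (Subtype.ext h2)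
      subst h3; subst h4; rfl
  have hsurj : ∀ x w, w.length < d → ∃ a, word a = x :: w := by
    intro x w hw
    rcases x with i | i
    · exact ⟨Sum.inl ⟨i, e ⟨w, hw⟩⟩, by simp [word, lab, tl]⟩
    · exact ⟨Sum.inr ⟨i, e ⟨w, hw⟩⟩, by simp [word, lab, tl]⟩
  let A : Matrix J J ℂ := fun a b => if word b = tl a then 1 else 0
  let B : Matrix J (Fin 1) ℂ := fun a _ => if tl a = [] then 1 else 0
  let C : Matrix (Fin p) J ℂ := fun i a => c i (word a)
  let D : Matrix (Fin p) (Fin 1) ℂ := fun i _ => c i []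
  refine ⟨q, A, 1, B, 0, C, D, fun δ => ?_⟩
  have hs : (Sum.elim (fun a : Σ i : Fin m, Fin (q i) => δ a.1)
      (fun a : Σ i : Fin m, Fin (q i) => (starRingEnd ℂ) (δ a.1))) = fun a : J => letterVal δ (lab a) := by
    funext a
    rcases a with a | a <;> rfl
  rw [hs]
  -- key: action of the matrix
  have hA : ∀ (v : List (Fin m ⊕ Fin m) → ℂ) (a : J),
      (A *ᵥ fun b => v (word b)) a = if tl a = [] then 0 else v (tl a) := by
    intro v a
    simp only [Matrix.mulVec, dotProduct, A, ite_mul, one_mul, zero_mul]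
    split_ifs with h
    · refine Finset.sum_eq_zero fun b _ => ?_
      rw [if_neg]; rw [h]; simp [word]
    · obtain ⟨x, w, hw⟩ := List.exists_cons_of_ne_nil h
      have := htl a
      obtain ⟨b, hb⟩ := hsurj x w (by rw [hw] at this; simp at this; omega)
      rw [Finset.sum_eq_single b]
      · rw [if_pos (hb.trans hw.symm), hb, hw]
      · intro b' _ hne
        rw [if_neg]; intro h'; exact hne (hinj (h'.trans (hw.trans hb.symm)))
      · simp
  set L : Matrix J J ℂ := Matrix.diagonal (fun a : J => letterVal δ (lab a)) with hL
  have hunit : IsUnit (1 - L * A) := by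
    rw [← Matrix.mulVec_injective_iff_isUnit]
    rw [← Matrix.coe_mulVecLin, ← LinearMap.ker_eq_bot, LinearMap.ker_eq_bot']
    intro v hv
    rw [Matrix.mulVecLin_apply, Matrix.sub_mulVec, Matrix.one_mulVec, ← Matrix.mulVec_mulVec,
      sub_eq_zero] at hv
    let v' : List (Fin m ⊕ Fin m) → ℂ := Function.extend word v 0
    have hv' : v = fun b => v' (word b) := by
      funext b; exact (hinj.extend_apply v 0 b).symm
    have key : ∀ k, ∀ a, (tl a).length = k → v a = 0 := by
      intro k
      induction k with
      | zero =>
        intro a ha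
        rw [hv, hv', hL, Matrix.mulVec_diagonal, hA, if_pos (List.length_eq_zero_iff.1 ha), mul_zero]
      | succ k ih =>
        intro a ha
        have hne : tl a ≠ [] := by intro h; rw [h] at ha; simp at ha
        rw [hv, hv', hL, Matrix.mulVec_diagonal, hA, if_neg hne]
        obtain ⟨x, w, hw⟩ := List.exists_cons_of_ne_nil hne
        have h1 := htl a
        rw [hw] at h1 ha
        simp at h1 ha
        obtain ⟨b, hb⟩ := hsurj x w (by omega)
        have hb2 : tl b = w := (List.cons.inj hb).2
        have := ih b (by rw [hb2]; exact ha)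
        rw [hv'] at this
        simp only at this
        rw [hw, ← hb, this, mul_zero]
    funext a
    exact key _ a rfl
  refine ⟨hunit, fun i => ?_⟩
  let z : Matrix J (Fin 1) ℂ := fun a _ => wordVal δ (word a)
  have hz : (1 - L * A) * z = L * B := by
    ext a j
    have h1 : (A * z) a j = if tl a = [] then 0 else wordVal δ (tl a) := hA (wordVal δ) a
    rw [Matrix.sub_mul, Matrix.one_mul, Matrix.mul_assoc, Matrix.sub_apply, hL,
      Matrix.diagonal_mul, Matrix.diagonal_mul, h1]
    have h2 : z a j = letterVal δ (lab a) * wordVal δ (tl a) := by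
      simp [z, word, wordVal]
    rw [h2]
    simp only [B]
    split_ifs with h
    · rw [h]; simp [wordVal]
    · simp
  have hdet : IsUnit (1 - L * A).det := (Matrix.isUnit_iff_isUnit_det _).1 hunit
  rw [sub_zero, ← hz, Matrix.mul_assoc, Matrix.nonsing_inv_mul_cancel_left _ _ hdet]
  rw [Finsupp.sum_of_support_subset (c i) (s := insert [] (Finset.univ.image word))]
  · rw [Finset.sum_insert (by simp [word]), Finset.sum_image (fun a _ b _ h => hinj h)]
    rw [Matrix.add_apply, Matrix.mul_apply]
    simp [C, D, z, wordVal]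
  · intro w hw
    have := hd i w hw
    rcases w with _ | ⟨x, w⟩
    · simp
    · obtain ⟨b, hb⟩ := hsurj x w (by simp at this; omega)
      rw [← hb]; simp
  · simp

theorem posDef_iff_sphere {n : ℕ} {M : Matrix (Fin n) (Fin n) ℂ} (hM : M.IsHermitian) :
    M.PosDef ↔ ∀ v ∈ Metric.sphere (0 : Fin n → ℂ) 1, 0 < (star v ⬝ᵥ (M *ᵥ v)).re := by
  constructor
  · intro h v hv
    have hv0 : v ≠ 0 := by
      rintro rfl
      simp at hv
    exact (Complex.pos_iff.1 (h.dotProduct_mulVec_pos hv0)).1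
  · intro h
    refine Matrix.PosDef.of_dotProduct_mulVec_pos hM fun x hx => ?_
    have him : (star x ⬝ᵥ (M *ᵥ x)).im = 0 := hM.im_star_dotProduct_mulVec_self x
    rw [Complex.pos_iff]
    refine ⟨?_, him.symm⟩
    have hx' : 0 < ‖x‖ := norm_pos_iff.2 hx
    have h1 := h (((‖x‖⁻¹ : ℝ) : ℂ) • x) (by
      rw [mem_sphere_zero_iff_norm, norm_smul]
      simp [hx'.ne'])
    rw [star_smul, Matrix.mulVec_smul, dotProduct_smul, smul_dotProduct] at h1
    simp only [smul_eq_mul, Complex.star_def, Complex.conj_ofReal, Complex.re_ofReal_mul] at h1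
    have h2 : 0 < ‖x‖⁻¹ := inv_pos.2 hx'
    exact pos_of_mul_pos_right (pos_of_mul_pos_right h1 h2.le) h2.le

theorem isOpen_sphere_pos (n : ℕ) :
    IsOpen {M : Matrix (Fin n) (Fin n) ℂ |
      ∀ v ∈ Metric.sphere (0 : Fin n → ℂ) 1, 0 < (star v ⬝ᵥ (M *ᵥ v)).re} := by
  rw [isOpen_iff_mem_nhds]
  intro M hM
  refine (isCompact_sphere (0 : Fin n → ℂ) 1).eventually_forall_of_forall_eventually fun v hv => ?_
  have hc : Continuous fun z : Matrix (Fin n) (Fin n) ℂ × (Fin n → ℂ) =>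
      (star z.2 ⬝ᵥ (z.1 *ᵥ z.2)).re := by
    fun_prop
  exact (isOpen_lt continuous_const hc).mem_nhds (hM v hv)

/-- density of the word combinations -/
theorem dense_words {m : ℕ} (K : Set (Fin m → ℂ)) (hK : IsCompact K) (g : C(K, ℂ))
    (ε : ℝ) (hε : 0 < ε) :
    ∃ c : List (Fin m ⊕ Fin m) →₀ ℂ, ∀ δ : K,
      dist (c.sum (fun w a => a * wordVal δ.1 w)) (g δ) < ε := by
  have : CompactSpace K := isCompact_iff_compactSpace.1 hK
  let gen : Fin m ⊕ Fin m → C(K, ℂ) := Sum.elim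
    (fun i => ⟨fun δ => δ.1 i, (continuous_apply i).comp continuous_subtype_val⟩)
    (fun i => ⟨fun δ => (starRingEnd ℂ) (δ.1 i),
      Complex.continuous_conj.comp ((continuous_apply i).comp continuous_subtype_val)⟩)
  have hgen : ∀ x (δ : K), gen x δ = letterVal δ.1 x := by
    rintro (i | i) δ <;> rfl
  have hprod : ∀ (w : List (Fin m ⊕ Fin m)) (δ : K), (w.map gen).prod δ = wordVal δ.1 w := by
    intro w δ
    induction w with
    | nil => simp [wordVal]
    | cons x w ih =>
      rw [List.map_cons, List.prod_cons, ContinuousMap.mul_apply, ih, hgen]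
      simp [wordVal]
  have hstar : Set.range gen ∪ star (Set.range gen) = Set.range gen := by
    refine Set.union_eq_self_of_subset_right ?_
    rintro f ⟨x, hx⟩
    refine ⟨x.swap, ?_⟩
    rw [← star_star f, ← hx]
    ext δ
    rcases x with i | i
    · rfl
    · exact (Complex.conj_conj _).symm
  let S : StarSubalgebra ℂ C(K, ℂ) := StarAlgebra.adjoin ℂ (Set.range gen)
  have hsep : S.SeparatesPoints := by
    intro a b hab
    have : a.1 ≠ b.1 := fun h => hab (Subtype.ext h)
    obtain ⟨i, hi⟩ := Function.ne_iff.1 this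
    exact ⟨_, ⟨gen (Sum.inl i), StarAlgebra.subset_adjoin ℂ _ ⟨_, rfl⟩, rfl⟩, hi⟩
  have htop := ContinuousMap.starSubalgebra_topologicalClosure_eq_top_of_separatesPoints S hsep
  have hg : g ∈ S.topologicalClosure := by rw [htop]; trivial
  have hg' : g ∈ closure (S : Set C(K, ℂ)) := by
    rwa [← StarSubalgebra.topologicalClosure_coe]
  obtain ⟨f, hf, hfg⟩ := Metric.mem_closure_iff.1 hg' ε hε
  have hf2 : f ∈ Submodule.span ℂ (Set.range fun w : List (Fin m ⊕ Fin m) => (w.map gen).prod) := by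
    have h1 : f ∈ Algebra.adjoin ℂ (Set.range gen) := by
      rw [← hstar, ← StarAlgebra.adjoin_toSubalgebra]; exact hf
    have h2 : f ∈ Subalgebra.toSubmodule (Algebra.adjoin ℂ (Set.range gen)) := h1
    rw [Algebra.adjoin_eq_span] at h2
    refine Submodule.span_mono ?_ h2
    intro y hy
    obtain ⟨l, hl, rfl⟩ := Submonoid.exists_list_of_mem_closure hy
    have : l ∈ Set.range (List.map gen) := by
      rw [Set.range_list_map]; exact hl
    obtain ⟨w, rfl⟩ := this
    exact ⟨w, rfl⟩
  obtain ⟨c, hc⟩ := Finsupp.mem_span_range_iff_exists_finsupp.1 hf2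
  refine ⟨c, fun δ => ?_⟩
  have h3 : c.sum (fun w a => a * wordVal δ.1 w) = f δ := by
    rw [← hc, Finsupp.sum, Finsupp.sum, ContinuousMap.sum_apply]
    refine Finset.sum_congr rfl fun w _ => ?_
    rw [ContinuousMap.smul_apply, hprod, smul_eq_mul]
  rw [h3, dist_comm]
  exact (ContinuousMap.dist_apply_le_dist δ).trans_lt hfg

/-- Corollary `cor:corours`: a pointwise feasible
complex-parameter-dependent LMI on a nonempty compact `K ⊆ ℂ^m` admits a
solution given by an implicit linear fractional representation (ILFR)
`x^*(δ) = D + C (E − Δ̄(δ) A)⁻¹ (Δ̄(δ) B − F)` where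
`Δ̄(δ) = diag(δ₁ I_{q₁}, …, δ_m I_{q_m}, conj(δ₁) I_{q₁}, …, conj(δ_m) I_{q_m})`.
The block-diagonal structure is encoded with the index type
`(Σ i, Fin (q i)) ⊕ (Σ i, Fin (q i))`, whose cardinality is `N = 2(q₁ + ⋯ + q_m)`. -/
theorem stmt7 (m n p : ℕ) (hm : 0 < m) (hn : 0 < n) (hp : 0 < p)
    (K : Set (Fin m → ℂ)) (hK : IsCompact K) (hKne : K.Nonempty)
    (G0 : (Fin m → ℂ) → Matrix (Fin n) (Fin n) ℂ)
    (G : Fin p → (Fin m → ℂ) → Matrix (Fin n) (Fin n) ℂ)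
    (hG0c : ContinuousOn G0 K) (hG0h : ∀ δ ∈ K, (G0 δ).IsHermitian)
    (hGc : ∀ i, ContinuousOn (G i) K)
    (hfeas : ∀ δ ∈ K, ∃ x : Fin p → ℂ,
      (G0 δ + ∑ i, (x i • G i δ + (starRingEnd ℂ) (x i) • (G i δ)ᴴ)).PosDef) :
    ∃ q : Fin m → ℕ,
    ∃ A E : Matrix ((Σ i : Fin m, Fin (q i)) ⊕ (Σ i : Fin m, Fin (q i)))
        ((Σ i : Fin m, Fin (q i)) ⊕ (Σ i : Fin m, Fin (q i))) ℂ,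
    ∃ B F : Matrix ((Σ i : Fin m, Fin (q i)) ⊕ (Σ i : Fin m, Fin (q i))) (Fin 1) ℂ,
    ∃ C : Matrix (Fin p) ((Σ i : Fin m, Fin (q i)) ⊕ (Σ i : Fin m, Fin (q i))) ℂ,
    ∃ D : Matrix (Fin p) (Fin 1) ℂ,
      ∀ δ ∈ K,
        IsUnit (E - Matrix.diagonal
            (Sum.elim (fun a : Σ i : Fin m, Fin (q i) => δ a.1)
              (fun a : Σ i : Fin m, Fin (q i) => (starRingEnd ℂ) (δ a.1))) * A) ∧
        (G0 δ + ∑ i,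
          (((D + C * (E - Matrix.diagonal
              (Sum.elim (fun a : Σ i : Fin m, Fin (q i) => δ a.1)
                (fun a : Σ i : Fin m, Fin (q i) => (starRingEnd ℂ) (δ a.1))) * A)⁻¹ *
            (Matrix.diagonal
              (Sum.elim (fun a : Σ i : Fin m, Fin (q i) => δ a.1)
                (fun a : Σ i : Fin m, Fin (q i) => (starRingEnd ℂ) (δ a.1))) * B - F)) i 0) •
              G i δ +
            (starRingEnd ℂ)
              ((D + C * (E - Matrix.diagonal
                (Sum.elim (fun a : Σ i : Fin m, Fin (q i) => δ a.1)
                  (fun a : Σ i : Fin m, Fin (q i) => (starRingEnd ℂ) (δ a.1))) * A)⁻¹ *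
              (Matrix.diagonal
                (Sum.elim (fun a : Σ i : Fin m, Fin (q i) => δ a.1)
                  (fun a : Σ i : Fin m, Fin (q i) => (starRingEnd ℂ) (δ a.1))) * B - F)) i 0) •
              (G i δ)ᴴ)).PosDef := by
  
  have : CompactSpace K := isCompact_iff_compactSpace.1 hK
  let Φ : K × (Fin p → ℂ) → Matrix (Fin n) (Fin n) ℂ := fun z =>
    G0 z.1 + ∑ i, (z.2 i • G i z.1 + (starRingEnd ℂ) (z.2 i) • (G i z.1)ᴴ)
  have hΦh : ∀ z, (Φ z).IsHermitian := by
    intro z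
    refine (hG0h z.1 z.1.2).add ?_
    unfold Matrix.IsHermitian
    rw [Matrix.conjTranspose_sum]
    refine Finset.sum_congr rfl fun i _ => ?_
    rw [Matrix.conjTranspose_add, Matrix.conjTranspose_smul, Matrix.conjTranspose_smul,
      Matrix.conjTranspose_conjTranspose, add_comm]
    simp
  have hΦc : Continuous Φ := by
    have h0 : Continuous fun z : K × (Fin p → ℂ) => G0 z.1 :=
      (continuousOn_iff_continuous_domRestrict.1 hG0c).comp continuous_fst
    have h1 : ∀ i, Continuous fun z : K × (Fin p → ℂ) => G i z.1 := fun i =>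
      (continuousOn_iff_continuous_domRestrict.1 (hGc i)).comp continuous_fst
    have h2 : ∀ i, Continuous fun z : K × (Fin p → ℂ) => z.2 i := fun i => by fun_prop
    refine h0.add (continuous_finsetSum _ fun i _ => ?_)
    exact ((h2 i).smul (h1 i)).add
      ((Complex.continuous_conj.comp (h2 i)).smul (h1 i).matrix_conjTranspose)
  let V : Set (K × (Fin p → ℂ)) := {z | (Φ z).PosDef}
  have hV : IsOpen V := by
    have : V = Φ ⁻¹' {M | ∀ v ∈ Metric.sphere (0 : Fin n → ℂ) 1,
        0 < (star v ⬝ᵥ (M *ᵥ v)).re} := by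
      ext z
      exact posDef_iff_sphere (hΦh z)
    rw [this]
    exact (isOpen_sphere_pos n).preimage hΦc
  obtain ⟨g, hg⟩ : ∃ g : C(K, Fin p → ℂ), ∀ δ, g δ ∈ {x | (δ, x) ∈ V} := by
    refine exists_continuous_forall_mem_convex_of_local_const ?_ ?_
    · intro δ x hx y hy a b ha hb hab
      have hx : (Φ (δ, x)).PosDef := hx
      have hy : (Φ (δ, y)).PosDef := hy
      change (Φ (δ, a • x + b • y)).PosDef
      have key : Φ (δ, a • x + b • y) = a • Φ (δ, x) + b • Φ (δ, y) := by
        have h0 : G0 δ = a • G0 δ + b • G0 δ := by rw [← add_smul, hab, one_smul]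
        simp only [Φ]
        conv_lhs => rw [h0]
        simp only [smul_add, Finset.smul_sum, Finset.sum_add_distrib, Pi.add_apply, Pi.smul_apply,
          map_add, add_smul, Complex.real_smul, map_mul, Complex.conj_ofReal, mul_smul,
          Complex.coe_smul]
        abel
      rw [key]
      rcases ha.eq_or_lt with rfl | ha
      · have : b = 1 := by linarith
        subst this
        simpa using hy
      · rcases hb.eq_or_lt with rfl | hb
        · have : a = 1 := by linarith
          subst this
          simpa using hx
        · exact (hx.smul ha).add (hy.smul hb)
    · intro δ
      obtain ⟨x, hx⟩ := hfeas δ δ.2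
      refine ⟨x, ?_⟩
      have hc : Continuous fun y : K => (y, x) := by fun_prop
      exact (hV.preimage hc).mem_nhds hx
  have hgr : IsCompact (Set.range fun δ : K => (δ, g δ)) :=
    isCompact_range (by fun_prop)
  obtain ⟨ε, hε, hsub⟩ := hgr.exists_thickening_subset_open hV (by
    rintro _ ⟨δ, rfl⟩
    exact hg δ)
  choose c hc using fun i : Fin p =>
    dense_words K hK ⟨fun δ => g δ i, by fun_prop⟩ ε hε
  obtain ⟨q, A, E, B, F, C, D, h⟩ := realize m p c
  refine ⟨q, A, E, B, F, C, D, fun δ hδ => ⟨(h δ).1, ?_⟩⟩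
  simp only [(h δ).2]
  have hmem : ((⟨δ, hδ⟩ : K), fun i => (c i).sum (fun w a => a * wordVal δ w)) ∈ V := by
    refine hsub (Metric.mem_thickening_iff.2 ⟨_, ⟨⟨δ, hδ⟩, rfl⟩, ?_⟩)
    rw [Prod.dist_eq, dist_self]
    refine max_lt hε ((dist_pi_lt_iff hε).2 fun i => ?_)
    exact hc i ⟨δ, hδ⟩
  exact hmem
end

section
/- Fix positive integers k1, k2 and real matrices A11 ∈ ℝ^{k1×k1}, A12 ∈ ℝ^{k1×k2}, A21 ∈ ℝ^{k2×k1}, A22 ∈ ℝ^{k2×k2}, with A22 Schur stable, and for |δ| ≤ 1 set M(δ) = A11 + A12 (I − δ A22)^{-1} δ A21. Then the following are equivalent: (i) M(δ) is Schur stable for every δ ∈ ℂ with |δ| = 1; (ii) there exist a natural number ν and complex matrices P_0, P_1, …, P_ν ∈ ℂ^{k1×k1} such that, defining P(δ) = (Σ_{i=0}^{ν} P_i δ^i) + (Σ_{i=0}^{ν} P_i δ^i)*, for every δ ∈ ℂ with |δ| = 1 the Hermitian matrix P(δ) is positive definite and M(δ)* P(δ) M(δ) − P(δ) is negative definite. 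-/
open Matrix
open scoped ComplexOrder

section Helpers
open scoped Matrix.Norms.L2Operator

variable {k : ℕ}

theorem aux_posDef (H : Matrix (Fin k) (Fin k) ℂ) (hH : H.IsHermitian)
    (h1 : ‖1 - H‖ < 1) : H.PosDef := by
  refine PosDef.of_dotProduct_mulVec_pos hH fun x hx => ?_
  have him : (star x ⬝ᵥ (H *ᵥ x)).im = 0 := hH.im_star_dotProduct_mulVec_self x
  have hx' : 0 < ‖WithLp.toLp 2 x‖ := by
    rw [norm_pos_iff]; simpa using hx
  have e1 : star x ⬝ᵥ (H *ᵥ x) = star x ⬝ᵥ x - star x ⬝ᵥ ((1 - H) *ᵥ x) := by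
    simp [sub_mulVec]
  have e2 : star x ⬝ᵥ x = ((‖WithLp.toLp 2 x‖ ^ 2 : ℝ) : ℂ) := by
    have := inner_self_eq_norm_sq_to_K (𝕜 := ℂ) (WithLp.toLp 2 x)
    rw [EuclideanSpace.inner_eq_star_dotProduct] at this
    rw [dotProduct_comm]
    simpa using this
  have e3 : ‖star x ⬝ᵥ ((1 - H) *ᵥ x)‖ ≤ ‖1 - H‖ * ‖WithLp.toLp 2 x‖ ^ 2 := by
    have a := norm_inner_le_norm (𝕜 := ℂ) (WithLp.toLp 2 x) (WithLp.toLp 2 ((1 - H) *ᵥ x))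
    rw [EuclideanSpace.inner_eq_star_dotProduct] at a
    have b := l2_opNorm_mulVec (1 - H) (WithLp.toLp 2 x)
    rw [dotProduct_comm]
    refine a.trans ?_
    have : ‖WithLp.toLp 2 ((1 - H) *ᵥ x)‖ ≤ ‖1 - H‖ * ‖WithLp.toLp 2 x‖ := b
    nlinarith
  have e4 := (abs_le.1 ((Complex.abs_re_le_norm (star x ⬝ᵥ ((1 - H) *ᵥ x))).trans e3)).2
  rw [Complex.pos_iff]
  refine ⟨?_, him.symm⟩
  rw [e1, e2, Complex.sub_re, Complex.ofReal_re]
  nlinarith [pow_pos hx' 2]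

theorem aux_stable (hk : 0 < k) (A : Matrix (Fin k) (Fin k) ℂ)
    (h : ∀ μ ∈ spectrum ℂ A, ‖μ‖ < 1) : ∃ N, 0 < N ∧ ‖A ^ N‖ < 1 / 2 := by
  have : Nonempty (Fin k) := ⟨⟨0, hk⟩⟩
  have : CompleteSpace (Matrix (Fin k) (Fin k) ℂ) := FiniteDimensional.complete ℂ _
  have hs : spectralRadius ℂ A < (1 : NNReal) :=
    spectrum.spectralRadius_lt_of_forall_lt A (fun μ hμ => by
      have := h μ hμ
      rw [← NNReal.coe_lt_coe]; simpa using this)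
  obtain ⟨r, hr1, hr2⟩ := ENNReal.lt_iff_exists_nnreal_btwn.1 hs
  have hr2' : r < 1 := by exact_mod_cast hr2
  have ht := spectrum.pow_nnnorm_pow_one_div_tendsto_nhds_spectralRadius A
  have ev := ht.eventually (gt_mem_nhds hr1)
  have h0 : Filter.Tendsto (fun n : ℕ => r ^ n) Filter.atTop (nhds 0) :=
    tendsto_pow_atTop_nhds_zero_of_lt_one zero_le hr2'
  have ev2 := h0.eventually (gt_mem_nhds (show (0 : NNReal) < 1 / 2 by norm_num))
  obtain ⟨n, ⟨hn1, hn2⟩, hn3⟩ := ((ev.and ev2).and (Filter.eventually_gt_atTop 0)).exists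
  refine ⟨n, hn3, ?_⟩
  have hn : (0 : ℝ) < n := by exact_mod_cast hn3
  have : ‖A ^ n‖₊ < r ^ n := by
    have h2 := ENNReal.rpow_lt_rpow hn1 hn
    rw [← ENNReal.rpow_mul, one_div, inv_mul_cancel₀ hn.ne', ENNReal.rpow_one,
      ENNReal.rpow_natCast] at h2
    exact_mod_cast h2
  have := this.trans hn2
  rw [← NNReal.coe_lt_coe] at this
  simpa using this

theorem aux_uniform {X : Type*} [TopologicalSpace X] [CompactSpace X]
    (F : X → Matrix (Fin k) (Fin k) ℂ) (hF : Continuous F)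
    (h : ∀ x, ∃ N, 0 < N ∧ ‖F x ^ N‖ < 1 / 2) :
    ∃ N, 0 < N ∧ ∀ x, ‖F x ^ N‖ ≤ 1 / 2 := by
  have key : ∃ N, 0 < N ∧ ∀ x ∈ (Set.univ : Set X), ‖F x ^ N‖ ≤ 1 / 2 := by
    have hpow : ∀ (x : X) (a b : ℕ), 0 < b → ‖F x ^ a‖ ≤ 1 / 2 → ‖F x ^ (a * b)‖ ≤ 1 / 2 := by
      intro x a b hb h1
      rw [pow_mul]
      refine (norm_pow_le' _ hb).trans ?_
      calc ‖F x ^ a‖ ^ b ≤ ‖F x ^ a‖ ^ 1 :=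
            pow_le_pow_of_le_one (norm_nonneg _) (by linarith) hb
        _ ≤ 1 / 2 := by simpa using h1
    refine isCompact_univ.induction_on (p := fun s => ∃ N, 0 < N ∧ ∀ x ∈ s, ‖F x ^ N‖ ≤ 1 / 2)
      ⟨1, one_pos, by simp⟩ ?_ ?_ ?_
    · rintro s t hst ⟨N, h0, h1⟩
      exact ⟨N, h0, fun x hx => h1 x (hst hx)⟩
    · rintro s t ⟨N, h0, h1⟩ ⟨N', h0', h1'⟩
      refine ⟨N * N', by positivity, ?_⟩
      rintro x (hx | hx)
      · exact hpow _ _ _ h0' (h1 x hx)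
      · rw [mul_comm]; exact hpow _ _ _ h0 (h1' x hx)
    · intro x _
      obtain ⟨N, h0, h1⟩ := h x
      refine ⟨{y | ‖F y ^ N‖ < 1 / 2}, ?_, N, h0, fun y hy => le_of_lt hy⟩
      refine mem_nhdsWithin_of_mem_nhds (IsOpen.mem_nhds ?_ h1)
      exact isOpen_lt ((hF.pow N).norm) continuous_const
  simpa using key

/-- The function is the Hermitian part of a matrix polynomial on the circle. -/
def AuxRep (h : AddCircle (1 : ℝ) → Matrix (Fin k) (Fin k) ℂ) : Prop :=
  ∃ c : ℕ →₀ Matrix (Fin k) (Fin k) ℂ, ∀ x,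
    h x = c.sum (fun i a => (AddCircle.toCircle x : ℂ) ^ i • a) +
      (c.sum (fun i a => (AddCircle.toCircle x : ℂ) ^ i • a))ᴴ

theorem AuxRep.zero : AuxRep (k := k) (fun _ => 0) := ⟨0, fun x => by simp⟩

theorem AuxRep.add {f g : AddCircle (1 : ℝ) → Matrix (Fin k) (Fin k) ℂ}
    (hf : AuxRep f) (hg : AuxRep g) : AuxRep (fun x => f x + g x) := by
  obtain ⟨c, hc⟩ := hf
  obtain ⟨d, hd⟩ := hg
  refine ⟨c + d, fun x => ?_⟩
  rw [Finsupp.sum_add_index' (by simp) (by simp), conjTranspose_add]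
  refine (congrArg₂ (· + ·) (hc x) (hd x)).trans ?_
  abel

theorem AuxRep.sum {ι : Type*} (s : Finset ι)
    (f : ι → AddCircle (1 : ℝ) → Matrix (Fin k) (Fin k) ℂ)
    (hf : ∀ i, AuxRep (f i)) : AuxRep (fun x => ∑ i ∈ s, f i x) := by
  classical
  induction s using Finset.induction_on with
  | empty => simpa using AuxRep.zero
  | insert a s ha ih =>
    simp_rw [Finset.sum_insert ha]
    exact (hf a).add ih

theorem AuxRep.of_mem_span (f : C(AddCircle (1 : ℝ), ℂ))
    (hf : f ∈ Submodule.span ℂ (Set.range (@fourier (1 : ℝ)))) :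
    ∀ C : Matrix (Fin k) (Fin k) ℂ, AuxRep (fun x => f x • C + (f x • C)ᴴ) := by
  induction hf using Submodule.span_induction with
  | mem f hf =>
    obtain ⟨n, rfl⟩ := hf
    intro C
    obtain ⟨m, rfl | rfl⟩ := n.eq_nat_or_neg
    · refine ⟨Finsupp.single m C, fun x => ?_⟩
      rw [Finsupp.sum_single_index (by simp)]
      simp only [fourier_apply, AddCircle.toCircle_zsmul]
      simp
    · refine ⟨Finsupp.single m Cᴴ, fun x => ?_⟩
      rw [Finsupp.sum_single_index (by simp)]
      have e : fourier (-(m : ℤ)) x = star ((AddCircle.toCircle x : ℂ) ^ m) := by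
        rw [fourier_neg, fourier_apply, AddCircle.toCircle_zsmul]
        simp
      refine (congrArg (fun z : ℂ => z • C + (z • C)ᴴ) e).trans ?_
      rw [conjTranspose_smul, conjTranspose_smul, star_star, conjTranspose_conjTranspose, add_comm]
  | zero => intro C; simpa using AuxRep.zero
  | add f g _ _ hf hg =>
    intro C
    have := (hf C).add (hg C)
    convert this using 2 with x
    simp only [ContinuousMap.add_apply, add_smul, conjTranspose_add]
    abel
  | smul a f _ hf =>
    intro C
    have := hf (a • C)
    convert this using 2 with x
    simp only [ContinuousMap.smul_apply, smul_smul, smul_eq_mul, mul_comm]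

theorem aux_approx (P : AddCircle (1 : ℝ) → Matrix (Fin k) (Fin k) ℂ) (hP : Continuous P)
    (hH : ∀ x, (P x).IsHermitian) (ε : ℝ) (hε : 0 < ε) :
    ∃ Q : AddCircle (1 : ℝ) → Matrix (Fin k) (Fin k) ℂ, AuxRep Q ∧ ∀ x, ‖Q x - P x‖ < ε := by
  have : Fact ((0 : ℝ) < 1) := ⟨one_pos⟩
  let S : Fin k → Fin k → Matrix (Fin k) (Fin k) ℂ :=
    fun i j => (2⁻¹ : ℂ) • Matrix.single i j (1 : ℂ)
  let K : ℝ := ∑ i, ∑ j, 2 * ‖S i j‖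
  have hK : 0 ≤ K := by positivity
  let η := ε / (K + 1)
  have hη : 0 < η := by positivity
  have hex : ∀ i j, ∃ f : C(AddCircle (1 : ℝ), ℂ),
      f ∈ Submodule.span ℂ (Set.range (@fourier (1 : ℝ))) ∧ ∀ x, ‖f x - P x i j‖ < η := by
    intro i j
    let g : C(AddCircle (1 : ℝ), ℂ) := ⟨fun x => P x i j, hP.matrix_elem i j⟩
    have hg : g ∈ (Submodule.span ℂ (Set.range (@fourier (1 : ℝ)))).topologicalClosure := by
      rw [span_fourier_closure_eq_top]; trivial
    rw [← SetLike.mem_coe, Submodule.topologicalClosure_coe, Metric.mem_closure_iff] at hg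
    obtain ⟨f, hf, hfg⟩ := hg η hη
    refine ⟨f, hf, fun x => ?_⟩
    have := (ContinuousMap.dist_apply_le_dist (f := g) (g := f) x).trans_lt hfg
    rw [dist_comm, dist_eq_norm] at this
    exact this
  choose f hf hfP using hex
  have hPdec : ∀ x, P x = ∑ i, ∑ j, (P x i j • S i j + (P x i j • S i j)ᴴ) := by
    intro x
    have h1 : ∑ i, ∑ j, P x i j • S i j = (2⁻¹ : ℂ) • P x := by
      conv_rhs => rw [matrix_eq_sum_single (P x)]
      simp only [Finset.smul_sum, S, Matrix.smul_single, smul_eq_mul, mul_one]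
      simp only [mul_comm]
    simp_rw [Finset.sum_add_distrib, ← conjTranspose_sum, h1, conjTranspose_smul, (hH x).eq]
    rw [← add_smul]
    simp
    norm_num
  refine ⟨fun x => ∑ i, ∑ j, (f i j x • S i j + (f i j x • S i j)ᴴ), ?_, fun x => ?_⟩
  · exact AuxRep.sum _ _ fun i => AuxRep.sum _ _ fun j => AuxRep.of_mem_span _ (hf i j) _
  · have e : ∑ i, ∑ j, (f i j x • S i j + (f i j x • S i j)ᴴ) - P x
        = ∑ i, ∑ j, ((f i j x - P x i j) • S i j + ((f i j x - P x i j) • S i j)ᴴ) := by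
      conv_lhs => rw [hPdec x]
      simp only [← Finset.sum_sub_distrib, sub_smul, conjTranspose_sub]
      refine Finset.sum_congr rfl fun i _ => Finset.sum_congr rfl fun j _ => ?_
      abel
    simp only [e]
    calc _ ≤ ∑ i, ∑ j, η * (2 * ‖S i j‖) := by
          refine norm_sum_le_of_le _ fun i _ => norm_sum_le_of_le _ fun j _ => ?_
          refine (norm_add_le _ _).trans ?_
          rw [l2_opNorm_conjTranspose, norm_smul]
          nlinarith [hfP i j x, norm_nonneg (S i j)]
      _ = η * K := by simp only [K, Finset.mul_sum]
      _ < η * (K + 1) := by nlinarith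
      _ = ε := by simp only [η]; field_simp

theorem aux_main (F : AddCircle (1 : ℝ) → Matrix (Fin k) (Fin k) ℂ) (hF : Continuous F)
    (N : ℕ) (hN : 0 < N) (hFN : ∀ x, ‖F x ^ N‖ ≤ 1 / 2) :
    ∃ Q : AddCircle (1 : ℝ) → Matrix (Fin k) (Fin k) ℂ, AuxRep Q ∧
      ∀ x, (Q x).PosDef ∧ (-((F x)ᴴ * Q x * F x - Q x)).PosDef := by
  have : Fact ((0 : ℝ) < 1) := ⟨one_pos⟩
  obtain ⟨B, hB⟩ := isCompact_univ.exists_bound_of_continuousOn (f := F) hF.continuousOn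
  have hB0 : 0 ≤ B := (norm_nonneg _).trans (hB 0 trivial)
  let P : AddCircle (1 : ℝ) → Matrix (Fin k) (Fin k) ℂ :=
    fun x => ∑ i ∈ Finset.range N, (F x ^ i)ᴴ * F x ^ i
  have hPc : Continuous P := by
    refine continuous_finsetSum _ fun i _ => ?_
    exact (hF.pow i).matrix_conjTranspose.mul (hF.pow i)
  have hPH : ∀ x, (P x).IsHermitian := by
    intro x
    simp only [P, IsHermitian, conjTranspose_sum, conjTranspose_mul, conjTranspose_conjTranspose]
  let ε : ℝ := 1 / (2 * (1 + B ^ 2))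
  have hε : 0 < ε := by positivity
  have hε1 : ε * (1 + B ^ 2) = 1 / 2 := by simp only [ε]; field_simp
  obtain ⟨Q, hQ, hQP⟩ := aux_approx P hPc hPH ε hε
  refine ⟨Q, hQ, fun x => ?_⟩
  have hQH : (Q x)ᴴ = Q x := by
    obtain ⟨c, hc⟩ := hQ
    rw [hc x, conjTranspose_add, conjTranspose_conjTranspose, add_comm]
  obtain ⟨E, hE⟩ : ∃ E, E = Q x - P x := ⟨_, rfl⟩
  have hEn : ‖E‖ < ε := by rw [hE]; exact hQP x
  have hEH : Eᴴ = E := by rw [hE, conjTranspose_sub, hQH, (hPH x).eq]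
  have hQE : Q x = P x + E := by rw [hE]; abel
  have hFx : ‖F x‖ ≤ B := hB x trivial
  constructor
  · obtain ⟨n, rfl⟩ : ∃ n, N = n + 1 := ⟨N - 1, by omega⟩
    have e : Q x = (1 + E) + ∑ i ∈ Finset.range n, (F x ^ (i + 1))ᴴ * F x ^ (i + 1) := by
      rw [hQE]
      simp only [P]
      rw [Finset.sum_range_succ']
      simp only [pow_zero, conjTranspose_one, mul_one]
      abel
    rw [e]
    refine PosDef.add_posSemidef (aux_posDef _ ?_ ?_) ?_
    · simp [IsHermitian, hEH]
    · have : ‖1 - (1 + E)‖ = ‖E‖ := by simp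
      rw [this]
      nlinarith [sq_nonneg B]
    · exact posSemidef_sum _ fun i _ => posSemidef_conjTranspose_mul_self _
  · have tel : (F x)ᴴ * P x * F x - P x = (F x ^ N)ᴴ * F x ^ N - 1 := by
      have := Finset.sum_range_sub (fun i => (F x ^ i)ᴴ * F x ^ i) N
      simp only [pow_zero, conjTranspose_one, mul_one] at this
      rw [← this, Finset.sum_sub_distrib]
      simp only [P, Finset.mul_sum, Finset.sum_mul]
      congr 1
      refine Finset.sum_congr rfl fun i _ => ?_
      rw [pow_succ, conjTranspose_mul]
      noncomm_ring
    have e : (1 : Matrix (Fin k) (Fin k) ℂ) - -((F x)ᴴ * Q x * F x - Q x)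
        = (F x ^ N)ᴴ * F x ^ N + ((F x)ᴴ * E * F x - E) := by
      have : (F x)ᴴ * Q x * F x - Q x = ((F x)ᴴ * P x * F x - P x) + ((F x)ᴴ * E * F x - E) := by
        rw [hQE]; noncomm_ring
      rw [this, tel]; abel
    refine aux_posDef _ ?_ ?_
    · simp [IsHermitian, conjTranspose_mul, hQH, mul_assoc]
    · rw [e]
      have n1 : ‖(F x ^ N)ᴴ * F x ^ N‖ ≤ 1 / 4 := by
        rw [l2_opNorm_conjTranspose_mul_self]
        nlinarith [hFN x, norm_nonneg (F x ^ N)]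
      have n2 : ‖(F x)ᴴ * E * F x‖ ≤ ‖E‖ * B ^ 2 := by
        refine (norm_mul_le _ _).trans ?_
        have := norm_mul_le (F x)ᴴ E
        rw [l2_opNorm_conjTranspose] at this
        calc _ ≤ (‖F x‖ * ‖E‖) * ‖F x‖ := by gcongr
          _ ≤ (B * ‖E‖) * B := by gcongr
          _ = _ := by ring
      have n3 := norm_add_le ((F x ^ N)ᴴ * F x ^ N) ((F x)ᴴ * E * F x - E)
      have n4 := norm_sub_le ((F x)ᴴ * E * F x) E
      nlinarith [sq_nonneg B]

end Helpers

theorem aux_det {n : ℕ} (A : Matrix (Fin n) (Fin n) ℂ) (hA : ∀ μ ∈ spectrum ℂ A, ‖μ‖ < 1)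
    (δ : ℂ) (hδ : ‖δ‖ = 1) : (1 - δ • A).det ≠ 0 := by
  intro h0
  have hne : δ ≠ 0 := by rintro rfl; simp at hδ
  have : δ⁻¹ ∈ spectrum ℂ A := by
    rw [spectrum.mem_iff]
    intro hu
    have e : 1 - δ • A = δ • (algebraMap ℂ (Matrix (Fin n) (Fin n) ℂ) δ⁻¹ - A) := by
      rw [smul_sub, Algebra.algebraMap_eq_smul_one, smul_smul, mul_inv_cancel₀ hne, one_smul]
    rw [e, det_smul] at h0
    rw [isUnit_iff_isUnit_det, isUnit_iff_ne_zero] at hu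
    exact (mul_ne_zero (pow_ne_zero _ hne) hu) h0
  have := hA _ this
  rw [norm_inv, hδ] at this
  simp at this

theorem stmt10 (k1 k2 : ℕ) (hk1 : 0 < k1) (hk2 : 0 < k2)
    (A11 : Matrix (Fin k1) (Fin k1) ℝ) (A12 : Matrix (Fin k1) (Fin k2) ℝ)
    (A21 : Matrix (Fin k2) (Fin k1) ℝ) (A22 : Matrix (Fin k2) (Fin k2) ℝ)
    (hA22 : ∀ μ ∈ spectrum ℂ (A22.map (Complex.ofReal)), ‖μ‖ < 1)
    (M : ℂ → Matrix (Fin k1) (Fin k1) ℂ)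
    (hM : ∀ δ : ℂ, ‖δ‖ ≤ 1 →
      M δ = A11.map (Complex.ofReal) +
        A12.map (Complex.ofReal) *
          (1 - δ • A22.map (Complex.ofReal))⁻¹ * (δ • A21.map (Complex.ofReal))) :
    (∀ δ : ℂ, ‖δ‖ = 1 → ∀ μ ∈ spectrum ℂ (M δ), ‖μ‖ < 1) ↔
    (∃ ν : ℕ, ∃ Pm : Fin (ν + 1) → Matrix (Fin k1) (Fin k1) ℂ,
      ∀ δ : ℂ, ‖δ‖ = 1 →
        ((∑ i : Fin (ν + 1), δ ^ (i : ℕ) • Pm i) +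
            (∑ i : Fin (ν + 1), δ ^ (i : ℕ) • Pm i)ᴴ).PosDef ∧
        (-((M δ)ᴴ *
            ((∑ i : Fin (ν + 1), δ ^ (i : ℕ) • Pm i) +
              (∑ i : Fin (ν + 1), δ ^ (i : ℕ) • Pm i)ᴴ) * M δ -
            ((∑ i : Fin (ν + 1), δ ^ (i : ℕ) • Pm i) +
              (∑ i : Fin (ν + 1), δ ^ (i : ℕ) • Pm i)ᴴ))).PosDef) := by
  have : Fact ((0 : ℝ) < 1) := ⟨one_pos⟩
  constructor
  · intro h
    have hn : ∀ x : AddCircle (1 : ℝ), ‖(AddCircle.toCircle x : ℂ)‖ = 1 := fun x => Circle.norm_coe _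
    let F : AddCircle (1 : ℝ) → Matrix (Fin k1) (Fin k1) ℂ := fun x => M (AddCircle.toCircle x)
    have hF : Continuous F := by
      have e : F = fun x => A11.map (Complex.ofReal) +
        A12.map (Complex.ofReal) *
          ((1 - (AddCircle.toCircle x : ℂ) • A22.map (Complex.ofReal)).det⁻¹ •
            (1 - (AddCircle.toCircle x : ℂ) • A22.map (Complex.ofReal)).adjugate) *
          ((AddCircle.toCircle x : ℂ) • A21.map (Complex.ofReal)) := by
        funext x
        simp only [F]
        rw [hM _ (hn x).le, inv_def, Ring.inverse_eq_inv']
      rw [e]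
      have ct : Continuous fun x : AddCircle (1 : ℝ) => (AddCircle.toCircle x : ℂ) :=
        continuous_subtype_val.comp AddCircle.continuous_toCircle
      have c1 : Continuous fun x : AddCircle (1 : ℝ) =>
          (1 - (AddCircle.toCircle x : ℂ) • A22.map (Complex.ofReal)) :=
        continuous_const.sub (ct.smul continuous_const)
      refine continuous_const.add (Continuous.matrix_mul (Continuous.matrix_mul continuous_const
        ((c1.matrix_det.inv₀ fun x => aux_det _ hA22 _ (hn x)).smul c1.matrix_adjugate))
        (ct.smul continuous_const))
    obtain ⟨N, hN0, hN⟩ := aux_uniform F hF fun x => aux_stable hk1 _ (h _ (hn x))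
    obtain ⟨Q, ⟨c, hc⟩, hQ⟩ := aux_main F hF N hN0 hN
    obtain ⟨ν, hν⟩ : ∃ ν, c.support ⊆ Finset.range (ν + 1) := by
      refine ⟨c.support.sup id, fun i hi => ?_⟩
      have := Finset.le_sup (f := id) hi
      simp at this ⊢
      omega
    refine ⟨ν, fun i => c i, fun δ hδ => ?_⟩
    obtain ⟨x, hx⟩ := (AddCircle.homeomorphCircle (T := 1) one_ne_zero).surjective
      ⟨δ, by simpa [Submonoid.unitSphere] using hδ⟩
    rw [AddCircle.homeomorphCircle_apply] at hx
    have hx' : (AddCircle.toCircle x : ℂ) = δ := by rw [hx]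
    have := hQ x
    rw [hc x, Finsupp.sum_of_support_subset c hν _ (by simp), Finset.sum_range] at this
    simp only [F, hx'] at this
    exact this
  · rintro ⟨ν, Pm, hP⟩ δ hδ μ hμ
    obtain ⟨h1, h2⟩ := hP δ hδ
    generalize (∑ i : Fin (ν + 1), δ ^ (i : ℕ) • Pm i) +
            (∑ i : Fin (ν + 1), δ ^ (i : ℕ) • Pm i)ᴴ = P at h1 h2
    rw [← spectrum_toLin', ← Module.End.hasEigenvalue_iff_mem_spectrum] at hμ
    obtain ⟨v, hv⟩ := hμ.exists_hasEigenvector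
    have hv0 := hv.2
    have hv1 : M δ *ᵥ v = μ • v := by simpa using hv.apply_eq_smul
    have p1 := h1.dotProduct_mulVec_pos hv0
    have p2 := h2.dotProduct_mulVec_pos hv0
    have e : star v ⬝ᵥ (-((M δ)ᴴ * P * M δ - P) *ᵥ v)
        = (1 - (‖μ‖ ^ 2 : ℝ)) * (star v ⬝ᵥ (P *ᵥ v)) := by
      have : star v ⬝ᵥ (((M δ)ᴴ * P * M δ) *ᵥ v) = (star μ * μ) * (star v ⬝ᵥ (P *ᵥ v)) := by
        rw [mul_assoc, ← mulVec_mulVec, dotProduct_mulVec, vecMul_conjTranspose, star_star,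
          ← mulVec_mulVec, hv1, mulVec_smul, star_smul, smul_dotProduct, dotProduct_smul]
        simp only [smul_eq_mul]; ring
      rw [neg_mulVec, sub_mulVec, dotProduct_neg, dotProduct_sub, this]
      have : star μ * μ = ((‖μ‖ ^ 2 : ℝ) : ℂ) := by
        have := Complex.conj_mul' μ
        simpa using this
      rw [this]; ring
    rw [e] at p2
    rw [Complex.pos_iff] at p1 p2
    have p3 := p2.1
    rw [← Complex.ofReal_one, ← Complex.ofReal_sub, Complex.re_ofReal_mul] at p3
    have := pos_of_mul_pos_left p3 p1.1.le
    nlinarith [norm_nonneg μ]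
end
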